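/- arXiv:math/0404192 — 2 statements merged into one kernel-verified Lean document; each statement's English description precedes it below -/
import Mathlib

section
/- Let 1 ≤ p < q ≤ ∞, let (Ω,μ) be a finite probability space, and let F be a class of functions on Ω that is 1-bounded in the weak space L_{q,∞}(Ω,μ). Then for all 0 < t < 1/2, D(F, L_{p,∞}(Ω,μ), t) ≤ C·(p²q/(q−p))·v(F, c t)·log(1/t), where C, c > 0 are absolute constants (for q = ∞ the factor p²q/(q−p) is interpreted as p²). -/
open MeasureTheory Filter
open scoped ENNReal NNReal Pointwise BigOperators

/-- A finite subset `σ` of `Ω` is `t`-shattered by the class `F`: there is a level function `h`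
such that for every partition of `σ` (given by the subset `τ = σ₊`) some `f ∈ F` lies below `h`
on `σ₋ = σ \ τ` and above `h + t` on `σ₊ = τ`. -/
def Shatters {Ω : Type*} (F : Set (Ω → ℝ)) (t : ℝ) (σ : Finset Ω) : Prop :=
  ∃ h : Ω → ℝ, ∀ τ : Finset Ω, τ ⊆ σ →
    ∃ f ∈ F, (∀ x ∈ σ, x ∉ τ → f x ≤ h x) ∧ (∀ x ∈ τ, h x + t ≤ f x)

/-- The combinatorial dimension `v(F,t)`: the maximal cardinality of a `t`-shattered set. -/
noncomputable def combDim {Ω : Type*} (F : Set (Ω → ℝ)) (t : ℝ) : ℝ≥0∞ :=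
  ⨆ (σ : Finset Ω) (_ : Shatters F t σ), (σ.card : ℝ≥0∞)

/-- There are `m` functions in `F` that are pairwise `t`-separated in `L₂(μ)` for some
probability measure `μ` supported on a finite subset of `Ω` (given by weights `w` on `s`). -/
def KPSeparated {Ω : Type*} (F : Set (Ω → ℝ)) (t : ℝ) (m : ℕ) : Prop :=
  ∃ (s : Finset Ω) (w : Ω → ℝ) (f : Fin m → Ω → ℝ),
    (∀ x, 0 ≤ w x) ∧ (∑ x ∈ s, w x = 1) ∧ (∀ i, f i ∈ F) ∧
    ∀ i j : Fin m, i < j → t ^ 2 ≤ ∑ x ∈ s, w x * (f i x - f j x) ^ 2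

/-- The Koltchinskii–Pollard entropy `D(F,t) = log sup { m : KPSeparated F t m }`. -/
noncomputable def KPentropy {Ω : Type*} (F : Set (Ω → ℝ)) (t : ℝ) : ℝ≥0∞ :=
  ⨆ (m : ℕ) (_ : KPSeparated F t m), ENNReal.ofReal (Real.log m)

/-- `φ` is a generating function: convex on `[0,∞)`, `φ(0) = 0`, increasing to infinity. -/
def IsGenerating (φ : ℝ → ℝ) : Prop :=
  φ 0 = 0 ∧ ConvexOn ℝ (Set.Ici 0) φ ∧ MonotoneOn φ (Set.Ici 0) ∧
    Filter.Tendsto φ Filter.atTop Filter.atTop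

/-- The Lorentz norm `‖f‖_{Λ_φ}` on a finite probability space with weights `μ`:
`inf { λ > 0 : μ{|f|/λ ≥ t} ≤ 1/φ(t) for all t > 0 }`. -/
noncomputable def lorentzNorm {Ω : Type*} [Fintype Ω] (φ : ℝ → ℝ) (μ : Ω → ℝ)
    (f : Ω → ℝ) : ℝ :=
  sInf {l : ℝ | 0 < l ∧ ∀ t : ℝ, 0 < t →
    ∑ x ∈ Finset.univ.filter (fun x => t ≤ |f x| / l), μ x ≤ 1 / φ t}

/-- The entropy `D(F, X, t)` of `F` with respect to a norm `N`: the logarithm of the maximal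
number of functions of `F` that are pairwise `t`-separated in `N`. -/
noncomputable def entropyWrt {Ω : Type*} (N : (Ω → ℝ) → ℝ) (F : Set (Ω → ℝ)) (t : ℝ) :
    ℝ≥0∞ :=
  ⨆ (m : ℕ) (_ : ∃ f : Fin m → Ω → ℝ, (∀ i, f i ∈ F) ∧
      ∀ i j : Fin m, i < j → t ≤ N (f i - f j)),
    ENNReal.ofReal (Real.log m)


namespace EWL

open Classical

def ShA {ι κ : Type} (X : ℕ) (Y : ι → κ → ℕ) (S : Finset ι) (A : κ → Option (Fin X)) : Prop :=
  ∀ τ : Finset κ, ∃ i ∈ S, ∀ k a, A k = some a →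
    (k ∈ τ → (a : ℕ) < Y i k) ∧ (k ∉ τ → Y i k < (a : ℕ))

noncomputable def shF {ι κ : Type} [Fintype κ] (X : ℕ) (Y : ι → κ → ℕ) (S : Finset ι) :
    Finset (κ → Option (Fin X)) := Finset.univ.filter (fun A => ShA X Y S A)

lemma ShA.mono {ι κ : Type} {X : ℕ} {Y : ι → κ → ℕ} {S T : Finset ι}
    {A : κ → Option (Fin X)} (h : ShA X Y S A) (hST : S ⊆ T) : ShA X Y T A := by
  intro τ
  obtain ⟨i, hi, h⟩ := h τ
  exact ⟨i, hST hi, h⟩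

lemma sh_add {ι κ : Type} [Fintype κ] (X : ℕ) (Y : ι → κ → ℕ) (S S₁ S₂ : Finset ι)
    (h1 : S₁ ⊆ S) (h2 : S₂ ⊆ S) (x : κ) (a : Fin X)
    (hS1 : ∀ i ∈ S₁, Y i x < (a : ℕ)) (hS2 : ∀ i ∈ S₂, (a : ℕ) < Y i x) :
    (shF X Y S₁).card + (shF X Y S₂).card ≤ (shF X Y S).card := by
  rw [← Finset.card_union_add_card_inter]
  have hnone : ∀ A ∈ shF X Y S₁ ∩ shF X Y S₂, A x = none := by
    intro A hA
    simp only [shF, Finset.mem_inter, Finset.mem_filter, Finset.mem_univ, true_and] at hA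
    obtain ⟨hA1, hA2⟩ := hA
    rcases hb : A x with _ | b
    · rfl
    · exfalso
      obtain ⟨i, hi, hi'⟩ := hA1 {x}
      obtain ⟨j, hj, hj'⟩ := hA2 ∅
      have e1 := (hi' x b hb).1 (by simp)
      have e2 := (hj' x b hb).2 (by simp)
      have e3 := hS1 i hi
      have e4 := hS2 j hj
      omega
  have himg : ((shF X Y S₁ ∩ shF X Y S₂).image (fun A => Function.update A x (some a))).card
      = (shF X Y S₁ ∩ shF X Y S₂).card := by
    apply Finset.card_image_of_injOn
    intro A hA B hB hAB
    have hA' := hnone A (by simpa using hA)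
    have hB' := hnone B (by simpa using hB)
    funext k
    by_cases hk : k = x
    · rw [hk, hA', hB']
    · have := congrFun hAB k
      simpa [Function.update_of_ne hk] using this
  rw [← himg, ← Finset.card_union_of_disjoint]
  · apply Finset.card_le_card
    intro A hA
    simp only [Finset.mem_union, Finset.mem_image, Finset.mem_inter] at hA
    simp only [shF, Finset.mem_filter, Finset.mem_univ, true_and] at hA ⊢
    rcases hA with (hA | hA) | ⟨B, ⟨hB1, hB2⟩, rfl⟩
    · exact hA.mono h1
    · exact hA.mono h2
    · intro τ
      by_cases hx : x ∈ τ
      · obtain ⟨i, hi, hi'⟩ := hB2 τ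
        refine ⟨i, h2 hi, fun k b hk => ?_⟩
        by_cases hkx : k = x
        · subst hkx
          simp at hk
          subst hk
          exact ⟨fun _ => hS2 i hi, fun h => absurd hx h⟩
        · rw [Function.update_of_ne hkx] at hk
          exact hi' k b hk
      · obtain ⟨i, hi, hi'⟩ := hB1 τ
        refine ⟨i, h1 hi, fun k b hk => ?_⟩
        by_cases hkx : k = x
        · subst hkx
          simp at hk
          subst hk
          exact ⟨fun h => absurd h hx, fun _ => hS1 i hi⟩
        · rw [Function.update_of_ne hkx] at hk
          exact hi' k b hk
  · rw [Finset.disjoint_left]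
    intro A hA hA2
    simp only [Finset.mem_image] at hA2
    obtain ⟨B, hB, rfl⟩ := hA2
    simp only [shF, Finset.mem_union, Finset.mem_filter, Finset.mem_univ, true_and] at hA
    rcases hA with hA | hA
    · obtain ⟨i, hi, hi'⟩ := hA {x}
      have e1 := (hi' x a (by simp)).1 (by simp)
      have e3 := hS1 i hi
      omega
    · obtain ⟨i, hi, hi'⟩ := hA ∅
      have e1 := (hi' x a (by simp)).2 (by simp)
      have e3 := hS2 i hi
      omega

lemma tree {ι κ : Type} [Fintype κ] (X : ℕ) (Y : ι → κ → ℕ) (α : ℝ)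
    (hsplit : ∀ S : Finset ι, 2 ≤ S.card → ∃ (x : κ) (a : Fin X) (S₁ S₂ : Finset ι),
      S₁ ⊆ S ∧ S₂ ⊆ S ∧ S₁.Nonempty ∧ S₂.Nonempty ∧
      (∀ i ∈ S₁, Y i x < (a : ℕ)) ∧ (∀ i ∈ S₂, (a : ℕ) < Y i x) ∧
      (S.card : ℝ) ^ α ≤ (S₁.card : ℝ) ^ α + (S₂.card : ℝ) ^ α)
    (S : Finset ι) (hS : S.Nonempty) : (S.card : ℝ) ^ α ≤ ((shF X Y S).card : ℝ) := by
  induction S using Finset.strongInduction with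
  | H S ih =>
    by_cases h2 : 2 ≤ S.card
    · obtain ⟨x, a, S₁, S₂, h1, h2, hn1, hn2, hS1, hS2, hle⟩ := hsplit S h2
      have hs1 : S₁ ⊂ S := by
        refine ⟨h1, fun h => ?_⟩
        obtain ⟨i, hi⟩ := hn2
        have := hS1 i (h (h2 hi))
        have := hS2 i hi
        omega
      have hs2 : S₂ ⊂ S := by
        refine ⟨h2, fun h => ?_⟩
        obtain ⟨i, hi⟩ := hn1
        have := hS2 i (h (h1 hi))
        have := hS1 i hi
        omega
      have e1 := ih S₁ hs1 hn1
      have e2 := ih S₂ hs2 hn2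
      have e3 := sh_add X Y S S₁ S₂ h1 h2 x a hS1 hS2
      have e4 : ((shF X Y S₁).card : ℝ) + (shF X Y S₂).card ≤ (shF X Y S).card := by
        exact_mod_cast e3
      linarith
    · have hc : S.card = 1 := by
        have := hS.card_pos
        omega
      rw [hc]
      simp only [Nat.cast_one, Real.one_rpow]
      have : 1 ≤ (shF X Y S).card := by
        rw [Nat.one_le_iff_ne_zero, ← Nat.pos_iff_ne_zero, Finset.card_pos]
        refine ⟨fun _ => none, ?_⟩
        simp only [shF, Finset.mem_filter, Finset.mem_univ, true_and]
        intro τ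
        obtain ⟨i, hi⟩ := hS
        exact ⟨i, hi, by simp⟩
      exact_mod_cast this

lemma num_split (p N N1 N2 B : ℝ) (hp : 1 ≤ p) (hB : 0 < B) (h2 : 2 * B ≤ N)
    (hN1 : N - B ≤ N1) (hN2 : B / (4 : ℝ) ^ p ≤ N2) :
    N ^ (1 / (3 * p)) ≤ N1 ^ (1 / (3 * p)) + N2 ^ (1 / (3 * p)) := by
  have hN : 0 < N := by linarith
  set α := 1 / (3 * p) with hα
  have hα0 : 0 < α := by positivity
  have hα1 : α ≤ 1 := by
    rw [hα, div_le_one (by positivity)]; linarith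
  obtain ⟨β, hβ⟩ : ∃ β, β = B / N := ⟨_, rfl⟩
  have hBN : B = N * β := by rw [hβ]; field_simp
  have hβ0 : 0 < β := by rw [hβ]; positivity
  have hβ1 : β ≤ 1 / 2 := by
    rw [hβ, div_le_iff₀ hN]; linarith
  have e1 : N ^ α * (1 - β) ≤ N1 ^ α := by
    calc N ^ α * (1 - β) ≤ N ^ α * (1 - β) ^ α := by
          gcongr
          calc (1 - β) = (1 - β) ^ (1 : ℝ) := by simp
            _ ≤ (1 - β) ^ α := Real.rpow_le_rpow_of_exponent_ge (by linarith) (by linarith) hα1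
      _ = (N - B) ^ α := by
          rw [← Real.mul_rpow hN.le (by linarith), hBN]; ring_nf
      _ ≤ N1 ^ α := Real.rpow_le_rpow (by linarith) hN1 hα0.le
  have e0 : β ^ (3 * p) ≤ β / (4 : ℝ) ^ p := by
    have : β ^ (3 * p) = β * β ^ (3 * p - 1) := by
      rw [← Real.rpow_one_add' hβ0.le (by linarith)]; ring_nf
    rw [this, div_eq_mul_inv]
    gcongr
    calc β ^ (3 * p - 1) ≤ (1 / 2 : ℝ) ^ (3 * p - 1) :=
          Real.rpow_le_rpow hβ0.le hβ1 (by linarith)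
      _ ≤ (1 / 2 : ℝ) ^ (2 * p) :=
          Real.rpow_le_rpow_of_exponent_ge (by norm_num) (by norm_num) (by linarith)
      _ = ((4 : ℝ) ^ p)⁻¹ := by
          rw [Real.rpow_mul (by norm_num), ← Real.inv_rpow (by norm_num)]; norm_num
  have e2 : N ^ α * β ≤ N2 ^ α := by
    calc N ^ α * β = N ^ α * (β ^ (3 * p)) ^ α := by
          rw [← Real.rpow_mul hβ0.le, hα]
          have : 3 * p * (1 / (3 * p)) = 1 := by field_simp
          rw [this, Real.rpow_one]
      _ ≤ N ^ α * (β / (4 : ℝ) ^ p) ^ α := by gcongr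
      _ = (B / (4 : ℝ) ^ p) ^ α := by
          rw [← Real.mul_rpow hN.le (by positivity), hBN]; ring_nf
      _ ≤ N2 ^ α := Real.rpow_le_rpow (by positivity) hN2 hα0.le
  nlinarith

lemma count_bound {κ : Type} [Fintype κ] (X : ℕ) (D v : ℝ) (hD : 1 ≤ D)
    (T : Finset (κ → Option (Fin X)))
    (hT : ∀ A ∈ T, ((Finset.univ.filter (fun k => A k ≠ none)).card : ℝ) ≤ v) :
    (T.card : ℝ) ≤ D ^ v * Real.exp (Fintype.card κ * X / D) := by
  have hD0 : 0 < D := by linarith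
  set w : Option (Fin X) → ℝ := fun o => if o ≠ none then D⁻¹ else 1 with hw
  have hw0 : ∀ o, 0 ≤ w o := by intro o; simp only [hw]; split_ifs <;> positivity
  have hone : ∀ A ∈ T, 1 ≤ D ^ v * ∏ k, w (A k) := by
    intro A hA
    have : ∏ k, w (A k) = D⁻¹ ^ (Finset.univ.filter (fun k => A k ≠ none)).card := by
      simp only [hw, Finset.prod_ite, Finset.prod_const, one_pow, mul_one]
    rw [this, inv_pow, ← div_eq_mul_inv, le_div_iff₀ (by positivity), one_mul,
      ← Real.rpow_natCast]
    exact Real.rpow_le_rpow_of_exponent_le hD (hT A hA)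
  calc (T.card : ℝ) = ∑ A ∈ T, (1 : ℝ) := by simp
    _ ≤ ∑ A ∈ T, D ^ v * ∏ k, w (A k) := Finset.sum_le_sum hone
    _ ≤ ∑ A : κ → Option (Fin X), D ^ v * ∏ k, w (A k) := by
        apply Finset.sum_le_sum_of_subset_of_nonneg (Finset.subset_univ _)
        intro A _ _
        have := Finset.prod_nonneg (s := Finset.univ) (fun k _ => hw0 (A k))
        positivity
    _ = D ^ v * ∏ k : κ, ∑ o, w o := by
        rw [← Finset.mul_sum, Finset.prod_univ_sum]; simp
    _ = D ^ v * (1 + X / D) ^ (Fintype.card κ) := by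
        rw [Finset.prod_const, Fintype.sum_option]
        simp [hw, div_eq_mul_inv]
    _ ≤ D ^ v * Real.exp (Fintype.card κ * X / D) := by
        gcongr
        calc (1 + X / D) ^ (Fintype.card κ) ≤ (Real.exp (X / D)) ^ (Fintype.card κ) := by
              gcongr
              have := Real.add_one_le_exp (X / D)
              linarith
          _ = _ := by rw [← Real.exp_nat_mul]; ring_nf

lemma sampling {Ω J : Type} [Fintype Ω] (μ : Ω → ℝ) (hμ : ∀ x, 0 ≤ μ x) (hμ1 : ∑ x, μ x = 1)
    (s : Finset J) (Z : J → Ω → ℝ) (a b : ℝ) (hb : 0 < b)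
    (hZ0 : ∀ j ∈ s, ∀ x, 0 ≤ Z j x) (hZb : ∀ j ∈ s, ∀ x, Z j x ≤ b)
    (hZ : ∀ j ∈ s, a ≤ ∑ x, μ x * Z j x) (n : ℕ)
    (hn : (s.card : ℝ) * Real.exp (-(n * a / (4 * b))) < 1) :
    ∃ x : Fin n → Ω, ∀ j ∈ s, n * a / 4 ≤ ∑ k, Z j (x k) := by
  by_contra hcon
  push Not at hcon
  have hexp : ∀ j ∈ s, ∑ x, μ x * Real.exp (-(Z j x / b)) ≤ Real.exp (-(a / (2 * b))) := by
    intro j hj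
    have h1 : ∀ x, Real.exp (-(Z j x / b)) ≤ 1 - Z j x / b / 2 := by
      intro x
      set y := Z j x / b with hy
      have hy0 : 0 ≤ y := div_nonneg (hZ0 j hj x) hb.le
      have hy1 : y ≤ 1 := by rw [hy, div_le_one hb]; exact hZb j hj x
      rw [Real.exp_neg, inv_le_comm₀ (Real.exp_pos _) (by linarith)]
      have h2 := Real.add_one_le_exp y
      refine le_trans ?_ h2
      rw [inv_le_iff_one_le_mul₀ (by linarith)]
      nlinarith
    calc ∑ x, μ x * Real.exp (-(Z j x / b)) ≤ ∑ x, μ x * (1 - Z j x / b / 2) :=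
          Finset.sum_le_sum fun x _ => mul_le_mul_of_nonneg_left (h1 x) (hμ x)
      _ = 1 - (∑ x, μ x * Z j x) / (2 * b) := by
          rw [← hμ1, Finset.sum_div, ← Finset.sum_sub_distrib]
          refine Finset.sum_congr rfl fun x _ => ?_
          rw [hμ1]
          field_simp
      _ ≤ 1 - a / (2 * b) := by
          have := hZ j hj
          gcongr
      _ ≤ _ := by
          have := Real.add_one_le_exp (-(a / (2 * b)))
          linarith
  have hprod : ∀ x : Fin n → Ω, 0 ≤ ∏ k, μ (x k) := fun x => Finset.prod_nonneg fun k _ => hμ _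
  have : (1 : ℝ) < 1 := by
    calc (1 : ℝ) = (∑ x, μ x) ^ n := by rw [hμ1, one_pow]
      _ = ∑ x : Fin n → Ω, ∏ k, μ (x k) := by rw [Fintype.sum_pow]
      _ ≤ ∑ x : Fin n → Ω, ∑ j ∈ s,
            Real.exp (n * a / (4 * b)) * ∏ k, (μ (x k) * Real.exp (-(Z j (x k) / b))) := by
          refine Finset.sum_le_sum fun x _ => ?_
          obtain ⟨j, hj, hlt⟩ := hcon x
          refine le_trans ?_ (Finset.single_le_sum (f := fun j => Real.exp (n * a / (4 * b)) *
            ∏ k, (μ (x k) * Real.exp (-(Z j (x k) / b)))) ?_ hj)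
          · rw [Finset.prod_mul_distrib, ← Real.exp_sum, mul_left_comm, ← Real.exp_add]
            refine le_mul_of_one_le_right (hprod x) (Real.one_le_exp ?_)
            rw [Finset.sum_neg_distrib, ← Finset.sum_div]
            have : (∑ k, Z j (x k)) / b ≤ n * a / 4 / b := by gcongr
            have e : n * a / (4 * b) = n * a / 4 / b := by field_simp
            rw [e]; linarith
          · intro j _
            exact mul_nonneg (Real.exp_pos _).le (Finset.prod_nonneg fun k _ =>
              mul_nonneg (hμ _) (Real.exp_pos _).le)
      _ = ∑ j ∈ s, Real.exp (n * a / (4 * b)) * (∑ x, μ x * Real.exp (-(Z j x / b))) ^ n := by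
          rw [Finset.sum_comm]
          refine Finset.sum_congr rfl fun j _ => ?_
          rw [Fintype.sum_pow, Finset.mul_sum]
      _ ≤ ∑ j ∈ s, Real.exp (n * a / (4 * b)) * (Real.exp (-(a / (2 * b)))) ^ n := by
          refine Finset.sum_le_sum fun j hj => ?_
          have h0 : 0 ≤ ∑ x, μ x * Real.exp (-(Z j x / b)) :=
            Finset.sum_nonneg fun x _ => mul_nonneg (hμ _) (Real.exp_pos _).le
          have := hexp j hj
          gcongr
      _ = (s.card : ℝ) * Real.exp (-(n * a / (4 * b))) := by
          rw [Finset.sum_const, nsmul_eq_mul, ← Real.exp_nat_mul, ← Real.exp_add]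
          congr 2
          field_simp
          ring
      _ < 1 := hn
  exact lt_irrefl _ this


lemma oneD {ι : Type} (S : Finset ι) (y : ι → ℕ) (X : ℕ) (hX : ∀ i, y i < X) (p : ℝ) (hp : 1 ≤ p)
    (hup : ∀ a : ℕ, 2 * (S.filter (fun i => a ≤ y i)).card ≤ S.card →
      ((S.filter (fun i => a < y i)).card : ℝ) * (4 : ℝ) ^ p ≤ (S.filter (fun i => a ≤ y i)).card)
    (hdown : ∀ a : ℕ, 2 * (S.filter (fun i => y i ≤ a)).card ≤ S.card →
      ((S.filter (fun i => y i < a)).card : ℝ) * (4 : ℝ) ^ p ≤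
        (S.filter (fun i => y i ≤ a)).card) :
    ∃ M : ℕ, ∑ i ∈ S, (((y i - M) + (M - y i) : ℕ) : ℝ) ^ p ≤ 2 * S.card := by
  have h4 : (0 : ℝ) < (4 : ℝ) ^ p := by positivity
  have hex : ∃ M : ℕ, 2 * (S.filter (fun i => M < y i)).card ≤ S.card := by
    refine ⟨X, ?_⟩
    rw [Finset.filter_false_of_mem]
    · simp
    · intro i _
      have := hX i
      omega
  obtain ⟨M, hM1, hM2⟩ : ∃ M : ℕ, 2 * (S.filter (fun i => M < y i)).card ≤ S.card ∧
      2 * (S.filter (fun i => y i < M)).card ≤ S.card := by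
    refine ⟨Nat.find hex, Nat.find_spec hex, ?_⟩
    rcases hM : Nat.find hex with _ | N
    · simp
    · have := Nat.find_min hex (m := N) (by omega)
      have hs := Finset.card_filter_add_card_filter_not (s := S) (fun i => N < y i)
      have : S.filter (fun i => y i < N + 1) = S.filter (fun i => ¬ N < y i) := by
        refine Finset.filter_congr fun i _ => ?_
        omega
      rw [this]
      omega
  have hU : ∀ k : ℕ, 2 * (((S.filter (fun i => M + 1 + k ≤ y i)).card : ℝ) * ((4 : ℝ) ^ p) ^ k)
      ≤ S.card := by
    intro k
    induction k with
    | zero =>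
      simp only [add_zero, pow_zero, mul_one]
      exact_mod_cast hM1
    | succ k ih =>
      have h2 : 2 * (S.filter (fun i => M + 1 + k ≤ y i)).card ≤ S.card := by
        refine le_trans (Nat.mul_le_mul_left 2 (Finset.card_le_card ?_)) hM1
        intro i hi
        simp only [Finset.mem_filter] at hi ⊢
        exact ⟨hi.1, by omega⟩
      have h3 := hup _ h2
      have h5 : (S.filter (fun i => M + 1 + (k + 1) ≤ y i)) =
        S.filter (fun i => M + 1 + k < y i) := Finset.filter_congr fun i _ => by omega
      rw [h5, pow_succ]
      have : (0 : ℝ) ≤ ((4 : ℝ) ^ p) ^ k := by positivity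
      have := mul_le_mul_of_nonneg_right h3 this
      linarith
  have hDn : ∀ k : ℕ, 2 * (((S.filter (fun i => y i + 1 + k ≤ M)).card : ℝ) * ((4 : ℝ) ^ p) ^ k)
      ≤ S.card := by
    intro k
    induction k with
    | zero =>
      simp only [add_zero, pow_zero, mul_one]
      exact_mod_cast hM2
    | succ k ih =>
      by_cases hkM : k + 1 ≤ M
      · have h6 : (S.filter (fun i => y i + 1 + k ≤ M)) =
          S.filter (fun i => y i ≤ M - (k + 1)) := Finset.filter_congr fun i _ => by omega
        have h5 : (S.filter (fun i => y i + 1 + (k + 1) ≤ M)) =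
          S.filter (fun i => y i < M - (k + 1)) := Finset.filter_congr fun i _ => by omega
        rw [h6] at ih
        have h2 : 2 * (S.filter (fun i => y i ≤ M - (k + 1))).card ≤ S.card := by
          refine le_trans (Nat.mul_le_mul_left 2 (Finset.card_le_card ?_)) hM2
          intro i hi
          simp only [Finset.mem_filter] at hi ⊢
          exact ⟨hi.1, by omega⟩
        have h3 := hdown _ h2
        rw [h5, pow_succ]
        have : (0 : ℝ) ≤ ((4 : ℝ) ^ p) ^ k := by positivity
        have := mul_le_mul_of_nonneg_right h3 this
        linarith
      · rw [Finset.filter_false_of_mem]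
        · simp
        · intro i _
          omega
  refine ⟨M, ?_⟩
  set d : ι → ℕ := fun i => (y i - M) + (M - y i) with hd
  have hcount : ∀ k : ℕ, ((S.filter (fun i => k + 2 ≤ d i)).card : ℝ) * ((k + 2 : ℕ) : ℝ) ^ p
      ≤ S.card * (1 / 2) ^ (k + 1) := by
    intro k
    have h1 : (S.filter (fun i => k + 2 ≤ d i)).card ≤
        (S.filter (fun i => M + 1 + (k + 1) ≤ y i)).card +
        (S.filter (fun i => y i + 1 + (k + 1) ≤ M)).card := by
      refine le_trans (Finset.card_le_card ?_) (Finset.card_union_le _ _)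
      intro i hi
      simp only [Finset.mem_filter, Finset.mem_union, hd] at hi ⊢
      have := hi.2
      by_cases h : M ≤ y i
      · left; exact ⟨hi.1, by omega⟩
      · right; exact ⟨hi.1, by omega⟩
    have h1' : ((S.filter (fun i => k + 2 ≤ d i)).card : ℝ) ≤
        (S.filter (fun i => M + 1 + (k + 1) ≤ y i)).card +
        (S.filter (fun i => y i + 1 + (k + 1) ≤ M)).card := by exact_mod_cast h1
    have h2 := hU (k + 1)
    have h3 := hDn (k + 1)
    have h5 : (0 : ℝ) < ((4 : ℝ) ^ p) ^ (k + 1) := by positivity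
    have h6 : ((S.filter (fun i => k + 2 ≤ d i)).card : ℝ) * ((4 : ℝ) ^ p) ^ (k + 1) ≤ S.card := by
      have := mul_le_mul_of_nonneg_right h1' h5.le
      linarith
    have h7 : ((k + 2 : ℕ) : ℝ) ^ p ≤ ((2 : ℝ) ^ p) ^ (k + 1) := by
      have : ((k + 2 : ℕ) : ℝ) ≤ (2 : ℝ) ^ (k + 1) := by
        have : k + 1 + 1 ≤ 2 ^ (k + 1) := Nat.lt_two_pow_self
        exact_mod_cast this
      calc ((k + 2 : ℕ) : ℝ) ^ p ≤ ((2 : ℝ) ^ (k + 1)) ^ p := by gcongr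
        _ = ((2 : ℝ) ^ p) ^ (k + 1) := by
          rw [← Real.rpow_natCast, ← Real.rpow_natCast, ← Real.rpow_mul (by norm_num),
            ← Real.rpow_mul (by norm_num), mul_comm]
    have h8 : (4 : ℝ) ^ p = 2 ^ p * 2 ^ p := by
      rw [← Real.mul_rpow (by norm_num) (by norm_num)]; norm_num
    have h9 : (2 : ℝ) ^ (k + 1) ≤ ((2 : ℝ) ^ p) ^ (k + 1) := by
      gcongr
      calc (2 : ℝ) = 2 ^ (1 : ℝ) := by simp
        _ ≤ 2 ^ p := Real.rpow_le_rpow_of_exponent_le (by norm_num) hp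
    set P := ((2 : ℝ) ^ p) ^ (k + 1) with hP
    have hP0 : 0 < P := by positivity
    rw [h8, mul_pow, ← hP] at h6
    set c : ℝ := ((S.filter (fun i => k + 2 ≤ d i)).card : ℝ) with hc
    have hc0 : 0 ≤ c := by positivity
    calc c * ((k + 2 : ℕ) : ℝ) ^ p ≤ c * P := by gcongr
      _ ≤ S.card / P := by rw [le_div_iff₀ hP0]; linarith
      _ ≤ S.card / 2 ^ (k + 1) := by gcongr
      _ = _ := by rw [one_div, inv_pow, div_eq_mul_inv]
  have hX' : ∀ i, d i ≤ X + M := by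
    intro i
    have := hX i
    simp only [hd]
    omega
  have hpt : ∀ i, ((d i : ℕ) : ℝ) ^ p ≤ 1 + ∑ k ∈ Finset.range (X + M),
      if k + 2 ≤ d i then ((k + 2 : ℕ) : ℝ) ^ p else 0 := by
    intro i
    have hnn : ∀ k ∈ Finset.range (X + M),
        0 ≤ (if k + 2 ≤ d i then ((k + 2 : ℕ) : ℝ) ^ p else 0) := by
      intro k _
      split_ifs <;> positivity
    by_cases h : d i ≤ 1
    · have h1 : ((d i : ℕ) : ℝ) ^ p ≤ 1 :=
        Real.rpow_le_one (by positivity) (by exact_mod_cast h) (by linarith)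
      have := Finset.sum_nonneg hnn
      linarith
    · obtain ⟨k, hk⟩ : ∃ k, d i = k + 2 := ⟨d i - 2, by omega⟩
      have hk' : k ∈ Finset.range (X + M) := by
        rw [Finset.mem_range]
        have := hX' i
        omega
      have := Finset.single_le_sum hnn hk'
      rw [if_pos (by omega)] at this
      rw [hk] at this ⊢
      linarith
  calc ∑ i ∈ S, ((d i : ℕ) : ℝ) ^ p
      ≤ ∑ i ∈ S, (1 + ∑ k ∈ Finset.range (X + M),
        if k + 2 ≤ d i then ((k + 2 : ℕ) : ℝ) ^ p else 0) := Finset.sum_le_sum fun i _ => hpt i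
    _ = S.card + ∑ k ∈ Finset.range (X + M),
        ((S.filter (fun i => k + 2 ≤ d i)).card : ℝ) * ((k + 2 : ℕ) : ℝ) ^ p := by
        rw [Finset.sum_add_distrib, Finset.sum_comm]
        congr 1
        · simp
        · refine Finset.sum_congr rfl fun k _ => ?_
          rw [← Finset.sum_filter, Finset.sum_const, nsmul_eq_mul]
    _ ≤ S.card + ∑ k ∈ Finset.range (X + M), (S.card : ℝ) * (1 / 2) ^ (k + 1) := by
        exact add_le_add le_rfl (Finset.sum_le_sum fun k _ => hcount k)
    _ ≤ S.card + S.card * 1 := by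
        rw [← Finset.mul_sum]
        gcongr
        have : ∀ K : ℕ, ∑ k ∈ Finset.range K, (1 / 2 : ℝ) ^ (k + 1) = 1 - (1 / 2) ^ K := by
          intro K
          induction K with
          | zero => simp
          | succ K ih => rw [Finset.sum_range_succ, ih, pow_succ]; ring
        rw [this]
        have : (0 : ℝ) ≤ (1 / 2) ^ (X + M) := by positivity
        linarith
    _ = 2 * S.card := by ring

/-- existence of a good split -/
lemma split_exists {ι κ : Type} [Fintype κ] [Nonempty κ] (X : ℕ) (Y : ι → κ → ℕ)
    (hX : ∀ i k, Y i k < X) (G : ι → κ → ℝ) (δ t p : ℝ) (hp : 1 ≤ p) (hδ : 0 < δ)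
    (ht : 960 * δ = t)
    (hG : ∀ i j k, |G i k - G j k| ≤ δ * (|(Y i k : ℝ) - Y j k| + 1))
    (hsep : ∀ i j, i ≠ j → (Fintype.card κ : ℝ) * (t / 16) ^ p ≤ ∑ k, |G i k - G j k| ^ p)
    (S : Finset ι) (hS : 2 ≤ S.card) :
    ∃ (x : κ) (a : Fin X) (S₁ S₂ : Finset ι),
      S₁ ⊆ S ∧ S₂ ⊆ S ∧ S₁.Nonempty ∧ S₂.Nonempty ∧
      (∀ i ∈ S₁, Y i x < (a : ℕ)) ∧ (∀ i ∈ S₂, (a : ℕ) < Y i x) ∧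
      (S.card : ℝ) ^ (1 / (3 * p)) ≤
        (S₁.card : ℝ) ^ (1 / (3 * p)) + (S₂.card : ℝ) ^ (1 / (3 * p)) := by
  have ht0 : 0 < t := by linarith
  have h4 : (0 : ℝ) < (4 : ℝ) ^ p := by positivity
  have hS' : (2 : ℝ) ≤ S.card := by exact_mod_cast hS
  -- choose the coordinate
  obtain ⟨x, hx⟩ : ∃ x : κ, (S.card : ℝ) ^ 2 / 2 * (t / 16) ^ p ≤
      ∑ i ∈ S, ∑ j ∈ S, |G i x - G j x| ^ p := by
    by_contra hcon
    push Not at hcon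
    have h1 : ∑ x, ∑ i ∈ S, ∑ j ∈ S, |G i x - G j x| ^ p <
        ∑ x : κ, (S.card : ℝ) ^ 2 / 2 * (t / 16) ^ p :=
      Finset.sum_lt_sum_of_nonempty Finset.univ_nonempty fun x _ => hcon x
    have h2 : ∑ x, ∑ i ∈ S, ∑ j ∈ S, |G i x - G j x| ^ p =
        ∑ i ∈ S, ∑ j ∈ S, ∑ x, |G i x - G j x| ^ p := by
      rw [Finset.sum_comm]
      refine Finset.sum_congr rfl fun i _ => ?_
      rw [Finset.sum_comm]
    set w : ℝ := (Fintype.card κ : ℝ) * (t / 16) ^ p with hw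
    have hw0 : 0 ≤ w := by positivity
    have h3 : ∑ i ∈ S, ∑ j ∈ S.erase i, w ≤ ∑ i ∈ S, ∑ j ∈ S, ∑ x, |G i x - G j x| ^ p := by
      refine Finset.sum_le_sum fun i hi => ?_
      refine le_trans (Finset.sum_le_sum fun j hj => hsep i j (Finset.ne_of_mem_erase hj).symm) ?_
      refine Finset.sum_le_sum_of_subset_of_nonneg (Finset.erase_subset _ _) fun j _ _ => ?_
      exact Finset.sum_nonneg fun k _ => by positivity
    have h5 : ∑ i ∈ S, ∑ j ∈ S.erase i, w = S.card * ((S.card - 1) * w) := by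
      rw [Finset.sum_congr rfl (g := fun _ => ((S.card : ℝ) - 1) * w)]
      · simp
      · intro i hi
        rw [Finset.sum_const, Finset.card_erase_of_mem hi, nsmul_eq_mul, Nat.cast_sub (by omega)]
        simp
    rw [h2] at h1
    rw [h5] at h3
    rw [Finset.sum_const, nsmul_eq_mul, Finset.card_univ] at h1
    have h6 : (Fintype.card κ : ℝ) * ((S.card : ℝ) ^ 2 / 2 * (t / 16) ^ p) =
        (S.card : ℝ) ^ 2 / 2 * w := by rw [hw]; ring
    rw [h6] at h1
    have h7 : (S.card : ℝ) ^ 2 / 2 ≤ S.card * (S.card - 1) := by nlinarith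
    have h8 := mul_le_mul_of_nonneg_right h7 hw0
    linarith
  by_cases hup : ∀ a : ℕ, 2 * (S.filter (fun i => a ≤ Y i x)).card ≤ S.card →
      ((S.filter (fun i => a < Y i x)).card : ℝ) * (4 : ℝ) ^ p ≤
        (S.filter (fun i => a ≤ Y i x)).card
  swap
  · push Not at hup
    obtain ⟨a, ha1, ha2⟩ := hup
    have hsum := Finset.card_filter_add_card_filter_not (s := S) (fun i => a ≤ Y i x)
    have heq : S.filter (fun i => ¬ a ≤ Y i x) = S.filter (fun i => Y i x < a) :=
      Finset.filter_congr fun i _ => by omega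
    rw [heq] at hsum
    have hpos : 0 < (S.filter (fun i => a < Y i x)).card := by
      rw [Nat.pos_iff_ne_zero]
      intro h0
      rw [h0] at ha2
      simp only [Nat.cast_zero, zero_mul] at ha2
      have := Nat.cast_nonneg (α := ℝ) (S.filter (fun i => a ≤ Y i x)).card
      linarith
    have hle : (S.filter (fun i => a < Y i x)).card ≤ (S.filter (fun i => a ≤ Y i x)).card := by
      apply Finset.card_le_card
      intro i hi
      simp only [Finset.mem_filter] at hi ⊢
      exact ⟨hi.1, hi.2.le⟩
    have hne2 := Finset.card_pos.mp hpos
    have haX : a < X := by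
      obtain ⟨i, hi⟩ := hne2
      have := (Finset.mem_filter.mp hi).2
      have := hX i x
      omega
    refine ⟨x, ⟨a, haX⟩, S.filter (fun i => Y i x < a), S.filter (fun i => a < Y i x),
      Finset.filter_subset _ _, Finset.filter_subset _ _, Finset.card_pos.mp (by omega), hne2,
      fun i hi => (Finset.mem_filter.mp hi).2, fun i hi => (Finset.mem_filter.mp hi).2, ?_⟩
    refine num_split p _ _ _ ((S.filter (fun i => a ≤ Y i x)).card : ℝ) hp ?_ ?_ ?_ ?_
    · exact_mod_cast lt_of_lt_of_le hpos hle
    · exact_mod_cast ha1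
    · rw [← hsum]; push_cast; linarith
    · rw [div_le_iff₀ h4]; exact ha2.le
  by_cases hdn : ∀ a : ℕ, 2 * (S.filter (fun i => Y i x ≤ a)).card ≤ S.card →
      ((S.filter (fun i => Y i x < a)).card : ℝ) * (4 : ℝ) ^ p ≤
        (S.filter (fun i => Y i x ≤ a)).card
  swap
  · push Not at hdn
    obtain ⟨a, ha1, ha2⟩ := hdn
    have hsum := Finset.card_filter_add_card_filter_not (s := S) (fun i => Y i x ≤ a)
    have heq : S.filter (fun i => ¬ Y i x ≤ a) = S.filter (fun i => a < Y i x) :=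
      Finset.filter_congr fun i _ => by omega
    rw [heq] at hsum
    have hpos : 0 < (S.filter (fun i => Y i x < a)).card := by
      rw [Nat.pos_iff_ne_zero]
      intro h0
      rw [h0] at ha2
      simp only [Nat.cast_zero, zero_mul] at ha2
      have := Nat.cast_nonneg (α := ℝ) (S.filter (fun i => Y i x ≤ a)).card
      linarith
    have hle : (S.filter (fun i => Y i x < a)).card ≤ (S.filter (fun i => Y i x ≤ a)).card := by
      apply Finset.card_le_card
      intro i hi
      simp only [Finset.mem_filter] at hi ⊢
      exact ⟨hi.1, hi.2.le⟩
    have hne2 : (S.filter (fun i => a < Y i x)).Nonempty := Finset.card_pos.mp (by omega)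
    have haX : a < X := by
      obtain ⟨i, hi⟩ := hne2
      have := (Finset.mem_filter.mp hi).2
      have := hX i x
      omega
    refine ⟨x, ⟨a, haX⟩, S.filter (fun i => Y i x < a), S.filter (fun i => a < Y i x),
      Finset.filter_subset _ _, Finset.filter_subset _ _, Finset.card_pos.mp (by omega), hne2,
      fun i hi => (Finset.mem_filter.mp hi).2, fun i hi => (Finset.mem_filter.mp hi).2, ?_⟩
    rw [add_comm]
    refine num_split p _ _ _ ((S.filter (fun i => Y i x ≤ a)).card : ℝ) hp ?_ ?_ ?_ ?_
    · exact_mod_cast lt_of_lt_of_le hpos hle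
    · exact_mod_cast ha1
    · rw [← hsum]; push_cast; linarith
    · rw [div_le_iff₀ h4]; exact ha2.le
  exfalso
  obtain ⟨M, hM⟩ := oneD S (fun i => Y i x) X (fun i => hX i x) p hp hup hdn
  set d : ι → ℝ := fun i => (((Y i x - M) + (M - Y i x) : ℕ) : ℝ) with hd
  have hd0 : ∀ i, 0 ≤ d i := fun i => by positivity
  have hdabs : ∀ i, |(Y i x : ℝ) - M| ≤ d i := by
    intro i
    simp only [hd]
    rcases le_total M (Y i x) with h | h
    · rw [Nat.sub_eq_zero_of_le h, add_zero, Nat.cast_sub h, abs_of_nonneg]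
      have : (M : ℝ) ≤ Y i x := by exact_mod_cast h
      linarith
    · rw [Nat.sub_eq_zero_of_le h, zero_add, Nat.cast_sub h, abs_of_nonpos]
      · linarith
      · have : (Y i x : ℝ) ≤ M := by exact_mod_cast h
        linarith
  have hpair : ∀ i j, |G i x - G j x| ^ p ≤ (3 * δ) ^ p * (d i ^ p + d j ^ p + 1) := by
    intro i j
    have h1 : |G i x - G j x| ≤ δ * (d i + d j + 1) := by
      refine (hG i j x).trans ?_
      have := abs_sub_le (Y i x : ℝ) M (Y j x)
      have h2 := hdabs i
      have h3 := hdabs j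
      rw [abs_sub_comm] at h3
      gcongr
      linarith
    have hmax : ∀ z : ℝ, 0 ≤ z → d i ≤ z → d j ≤ z → 1 ≤ z →
        z ^ p ≤ d i ^ p + d j ^ p + 1 → |G i x - G j x| ^ p ≤
          (3 * δ) ^ p * (d i ^ p + d j ^ p + 1) := by
      intro z hz hz1 hz2 hz3 hz4
      calc |G i x - G j x| ^ p ≤ (3 * δ * z) ^ p := by
            gcongr
            refine h1.trans ?_
            nlinarith
        _ = (3 * δ) ^ p * z ^ p := Real.mul_rpow (by positivity) hz
        _ ≤ _ := by gcongr
    have hi0 : 0 ≤ d i ^ p := Real.rpow_nonneg (hd0 i) _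
    have hj0 : 0 ≤ d j ^ p := Real.rpow_nonneg (hd0 j) _
    by_cases c1 : d i ≤ 1 ∧ d j ≤ 1
    · exact hmax 1 zero_le_one c1.1 c1.2 le_rfl (by simp; linarith)
    rcases le_total (d i) (d j) with c2 | c2
    · refine hmax (d j) (hd0 j) c2 le_rfl ?_ (by linarith)
      by_contra c3
      exact c1 ⟨by linarith, by linarith⟩
    · refine hmax (d i) (hd0 i) le_rfl c2 ?_ (by linarith)
      by_contra c3
      exact c1 ⟨by linarith, by linarith⟩
  have htot : ∑ i ∈ S, ∑ j ∈ S, |G i x - G j x| ^ p ≤ (3 * δ) ^ p * (5 * (S.card : ℝ) ^ 2) := by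
    calc ∑ i ∈ S, ∑ j ∈ S, |G i x - G j x| ^ p
        ≤ ∑ i ∈ S, ∑ j ∈ S, (3 * δ) ^ p * (d i ^ p + d j ^ p + 1) :=
          Finset.sum_le_sum fun i _ => Finset.sum_le_sum fun j _ => hpair i j
      _ = (3 * δ) ^ p * (2 * (S.card * ∑ i ∈ S, d i ^ p) + (S.card : ℝ) ^ 2) := by
          simp only [← Finset.mul_sum, Finset.sum_add_distrib, Finset.sum_const, nsmul_eq_mul]
          ring
      _ ≤ (3 * δ) ^ p * (5 * (S.card : ℝ) ^ 2) := by
          have : (S.card : ℝ) * ∑ i ∈ S, d i ^ p ≤ S.card * (2 * S.card) := by gcongr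
          gcongr
          nlinarith
  have hcmp : (t / 16) ^ p = (3 * δ) ^ p * 20 ^ p := by
    rw [← Real.mul_rpow (by positivity) (by norm_num), ← ht]; ring_nf
  have h20 : (20 : ℝ) ≤ 20 ^ p := by
    calc (20 : ℝ) = 20 ^ (1 : ℝ) := by simp
      _ ≤ 20 ^ p := Real.rpow_le_rpow_of_exponent_le (by norm_num) hp
  rw [hcmp] at hx
  have hδp : 0 < (3 * δ) ^ p := by positivity
  have hSS : 0 < (S.card : ℝ) ^ 2 := by positivity
  have hprod : 0 < (3 * δ) ^ p * (S.card : ℝ) ^ 2 := by positivity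
  nlinarith [mul_le_mul_of_nonneg_left h20 hprod.le]


lemma supp_bound {Ω : Type} (F : Set (Ω → ℝ)) {m n : ℕ} (f : Fin m → Ω → ℝ)
    (hf : ∀ i, f i ∈ F) (R δ v : ℝ) (hδ : 0 < δ)
    (hv : ∀ σ : Finset Ω, Shatters F δ σ → (σ.card : ℝ) ≤ v)
    (X : ℕ) (hX : ∀ a : Fin X, (a : ℝ) * δ ≤ 2 * R) (x : Fin n → Ω) (Y : Fin m → Fin n → ℕ)
    (hY : ∀ i k, Y i k = ⌊(max (-R) (min R (f i (x k))) + R) / δ⌋₊)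
    (A : Fin n → Option (Fin X)) (hA : ShA X Y Finset.univ A) :
    ((Finset.univ.filter (fun k => A k ≠ none)).card : ℝ) ≤ v := by
  set σ := Finset.univ.filter (fun k => A k ≠ none) with hσ
  have hget : ∀ k ∈ σ, ∃ a, A k = some a := by
    intro k hk
    simp only [hσ, Finset.mem_filter, Finset.mem_univ, true_and] at hk
    exact Option.ne_none_iff_exists'.mp hk
  have hinj : Set.InjOn x (σ : Set (Fin n)) := by
    intro k hk l hl hkl
    by_contra hne
    obtain ⟨a, ha⟩ := hget k hk
    obtain ⟨b, hb⟩ := hget l hl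
    have hYY : ∀ i, Y i k = Y i l := by
      intro i; rw [hY, hY, hkl]
    obtain ⟨i, -, hi⟩ := hA {k}
    obtain ⟨j, -, hj⟩ := hA {l}
    have e1 := (hi k a ha).1 (by simp)
    have e2 := (hi l b hb).2 (by simpa using fun h => hne h.symm)
    have e3 := (hj l b hb).1 (by simp)
    have e4 := (hj k a ha).2 (by simpa using hne)
    have e5 := hYY i
    have e6 := hYY j
    omega
  rw [← Finset.card_image_of_injOn hinj]
  apply hv
  -- level function
  have hlev : ∃ h : Ω → ℝ, ∀ k ∈ σ, ∀ a, A k = some a → h (x k) = a * δ - R := by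
    refine ⟨fun ω => if H : ∃ k ∈ σ, x k = ω then
      (((A H.choose).map (fun a => (a : ℝ) * δ - R)).getD 0) else 0, ?_⟩
    intro k hk a ha
    have H : ∃ k' ∈ σ, x k' = x k := ⟨k, hk, rfl⟩
    have hc := H.choose_spec
    have : H.choose = k := hinj hc.1 hk hc.2
    simp only [dif_pos H]
    rw [this, ha]
    simp
  obtain ⟨h, hh⟩ := hlev
  refine ⟨h, fun τ hτ => ?_⟩
  obtain ⟨i, -, hi⟩ := hA (Finset.univ.filter (fun k => x k ∈ τ))
  refine ⟨f i, hf i, ?_, ?_⟩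
  · intro ω hω hωτ
    obtain ⟨k, hk, rfl⟩ := Finset.mem_image.mp hω
    obtain ⟨a, ha⟩ := hget k hk
    rw [hh k hk a ha]
    have e := (hi k a ha).2 (by simpa using hωτ)
    rw [hY, Nat.floor_lt (by
      have := le_max_left (-R) (min R (f i (x k)))
      exact div_nonneg (by linarith) hδ.le), div_lt_iff₀ hδ] at e
    have e2 := hX a
    have e3 := le_max_right (-R) (min R (f i (x k)))
    have e4 : min R (f i (x k)) < a * δ - R := by linarith
    rcases min_lt_iff.mp e4 with e5 | e5
    · linarith
    · exact e5.le
  · intro ω hωτ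
    obtain ⟨k, hk, rfl⟩ := Finset.mem_image.mp (hτ hωτ)
    obtain ⟨a, ha⟩ := hget k hk
    rw [hh k hk a ha]
    have e := (hi k a ha).1 (by simpa using hωτ)
    rw [hY] at e
    have e1 : ((a : ℕ) + 1 : ℕ) ≤ ⌊(max (-R) (min R (f i (x k))) + R) / δ⌋₊ := e
    rw [Nat.le_floor_iff' (by omega), le_div_iff₀ hδ] at e1
    push_cast at e1
    have ha0 : (0 : ℝ) ≤ (a : ℕ) := by positivity
    have e2 : (a : ℝ) * δ - R + δ ≤ max (-R) (min R (f i (x k))) := by linarith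
    have e0 : 0 ≤ (a : ℝ) * δ := by positivity
    rcases le_max_iff.mp e2 with e3 | e3
    · linarith
    · exact e3.trans (min_le_right _ _)

set_option maxHeartbeats 1000000 in
lemma core {Ω : Type} [Fintype Ω] (μ : Ω → ℝ) (hμ : ∀ x, 0 ≤ μ x) (hμ1 : ∑ x, μ x = 1)
    (F : Set (Ω → ℝ)) (m : ℕ) (hm : 2 ≤ m) (f : Fin m → Ω → ℝ) (hf : ∀ i, f i ∈ F)
    (p t R v : ℝ) (hp : 1 ≤ p) (ht : 0 < t) (ht2 : t < 1 / 2) (hR : 1 ≤ R) (hv0 : 0 ≤ v)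
    (hv : ∀ σ : Finset Ω, Shatters F (1 / 960 * t) σ → (σ.card : ℝ) ≤ v)
    (hsep : ∀ i j, i ≠ j → (t / 4) ^ p ≤
      ∑ x, μ x * |max (-R) (min R (f i x)) - max (-R) (min R (f j x))| ^ p) :
    Real.log m ≤ 144 * p ^ 2 * v * Real.log (R / t) := by
  set g : Fin m → Ω → ℝ := fun i x => max (-R) (min R (f i x)) with hg
  have hgl : ∀ i x, -R ≤ g i x := fun i x => le_max_left _ _
  have hgu : ∀ i x, g i x ≤ R := fun i x => max_le (by linarith) (min_le_left _ _)
  have hm' : (2 : ℝ) ≤ m := by exact_mod_cast hm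
  have hlogm : 1 / 2 ≤ Real.log m := by
    have := Real.log_le_log (by norm_num) hm'
    have := Real.log_two_gt_d9
    linarith
  set W := R / t with hW
  have hW2 : 2 ≤ W := by rw [hW, le_div_iff₀ ht]; linarith
  have hlW : 0.69 ≤ Real.log W := by
    have := Real.log_le_log (by norm_num) hW2
    have := Real.log_two_gt_d9
    linarith
  have hp0 : 0 < p := by linarith
  set B := (8 * W) ^ p with hB
  have hB1 : 1 ≤ B := Real.one_le_rpow (by linarith) hp0.le
  have hB0 : 0 < B := by linarith
  have hBab : (2 * R) ^ p = B * (t / 4) ^ p := by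
    rw [hB, ← Real.mul_rpow (by positivity) (by positivity), hW]
    congr 1
    field_simp
    ring
  have ha0 : 0 < (t / 4) ^ p := by positivity
  set n := ⌊8 * B * Real.log m⌋₊ + 1 with hn
  have hn1 : 8 * B * Real.log m < n := by
    rw [hn]; push_cast; exact Nat.lt_floor_add_one _
  have hn2 : (n : ℝ) ≤ 10 * B * Real.log m := by
    rw [hn]; push_cast
    have := Nat.floor_le (a := 8 * B * Real.log m) (by positivity)
    nlinarith
  obtain ⟨x, hx⟩ := sampling μ hμ hμ1 (Finset.univ : Finset (Fin m)).offDiag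
    (fun ij x => |g ij.1 x - g ij.2 x| ^ p) ((t / 4) ^ p) ((2 * R) ^ p) (by positivity)
    (fun _ _ _ => by positivity)
    (fun ij _ x => by
      have h1 := hgl ij.1 x
      have h2 := hgu ij.1 x
      have h3 := hgl ij.2 x
      have h4 := hgu ij.2 x
      gcongr
      rw [abs_le]; constructor <;> linarith)
    (fun ij hij => hsep ij.1 ij.2 (Finset.mem_offDiag.mp hij).2.2) n (by
      have e1 : (n : ℝ) * (t / 4) ^ p / (4 * (2 * R) ^ p) = n / (4 * B) := by
        rw [hBab]; field_simp
      rw [e1]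
      have e2 : ((Finset.univ : Finset (Fin m)).offDiag.card : ℝ) ≤ (m : ℝ) * m := by
        have : (Finset.univ : Finset (Fin m)).offDiag.card ≤ m * m := by
          rw [Finset.offDiag_card]; simp
        exact_mod_cast this
      have e3 : 2 * Real.log m < n / (4 * B) := by
        rw [lt_div_iff₀ (by positivity)]; linarith
      have e4 : Real.exp (-(n / (4 * B))) < Real.exp (-(2 * Real.log m)) :=
        Real.exp_lt_exp.mpr (by linarith)
      have e5 : Real.exp (-(2 * Real.log m)) = ((m : ℝ) * m)⁻¹ := by
        rw [Real.exp_neg, two_mul, Real.exp_add, Real.exp_log (by linarith)]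
      rw [e5] at e4
      have hmm : 0 < (m : ℝ) * m := by positivity
      calc _ ≤ (m : ℝ) * m * Real.exp (-(n / (4 * B))) := by gcongr
        _ < (m : ℝ) * m * ((m : ℝ) * m)⁻¹ := by gcongr
        _ = 1 := mul_inv_cancel₀ hmm.ne')
  set δ := 1 / 960 * t with hδ
  have hδ0 : 0 < δ := by positivity
  set X := ⌊2 * R / δ⌋₊ + 1 with hX
  set Y : Fin m → Fin n → ℕ := fun i k => ⌊(g i (x k) + R) / δ⌋₊ with hY
  have hYX : ∀ i k, Y i k < X := by
    intro i k
    rw [hX, Nat.lt_succ_iff]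
    apply Nat.floor_le_floor
    have := hgu i (x k)
    gcongr
    linarith
  have hnn : ∀ i k, 0 ≤ (g i (x k) + R) / δ := fun i k => by
    have := hgl i (x k)
    exact div_nonneg (by linarith) hδ0.le
  have hG : ∀ i j k, |g i (x k) - g j (x k)| ≤ δ * (|(Y i k : ℝ) - Y j k| + 1) := by
    intro i j k
    have a1 := Nat.floor_le (hnn i k)
    have a2 := Nat.lt_floor_add_one ((g i (x k) + R) / δ)
    have a3 := Nat.floor_le (hnn j k)
    have a4 := Nat.lt_floor_add_one ((g j (x k) + R) / δ)
    have e : g i (x k) - g j (x k) = δ * ((g i (x k) + R) / δ - (g j (x k) + R) / δ) := by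
      field_simp
      ring
    rw [e, abs_mul, abs_of_pos hδ0]
    refine mul_le_mul_of_nonneg_left ?_ hδ0.le
    have a5 := le_abs_self ((Y i k : ℝ) - Y j k)
    have a6 := neg_abs_le ((Y i k : ℝ) - Y j k)
    simp only [hY] at a5 a6 ⊢
    rw [abs_le]
    constructor <;> linarith
  have : Nonempty (Fin n) := ⟨⟨0, by omega⟩⟩
  have hsplit := split_exists X Y hYX (fun i k => g i (x k)) δ t p hp hδ0 (by rw [hδ]; ring) hG
    (fun i j hij => by
      refine le_trans ?_ (hx (i, j) (by simpa using hij))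
      rw [Fintype.card_fin, mul_div_assoc]
      refine mul_le_mul_of_nonneg_left ?_ (by positivity)
      have : (t / 16) ^ p = (t / 4) ^ p * (1 / 4) ^ p := by
        rw [← Real.mul_rpow (by positivity) (by norm_num)]; ring_nf
      rw [this, div_eq_mul_inv]
      refine mul_le_mul_of_nonneg_left ?_ ha0.le
      calc (1 / 4 : ℝ) ^ p ≤ (1 / 4) ^ (1 : ℝ) :=
            Real.rpow_le_rpow_of_exponent_ge (by norm_num) (by norm_num) hp
        _ = 4⁻¹ := by norm_num)
  have : Nonempty (Fin m) := ⟨⟨0, by omega⟩⟩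
  have htree := tree X Y (1 / (3 * p)) hsplit Finset.univ Finset.univ_nonempty
  rw [Finset.card_univ, Fintype.card_fin] at htree
  have hX1 : (1 : ℝ) ≤ X := by rw [hX]; push_cast; linarith [Nat.cast_nonneg (α := ℝ) ⌊2 * R / δ⌋₊]
  set D := 60 * p * X * B with hD
  have hD1 : 1 ≤ D := by
    have : 1 ≤ p * X := by nlinarith
    have : 1 ≤ p * X * B := by nlinarith
    rw [hD]; nlinarith
  have hcount := count_bound X D v hD1 (shF X Y Finset.univ) (by
    intro A hA
    simp only [shF, Finset.mem_filter, Finset.mem_univ, true_and] at hA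
    refine supp_bound F f hf R δ v hδ0 hv X ?_ x Y (fun i k => rfl) A hA
    intro a
    have h1 : (a : ℕ) ≤ ⌊2 * R / δ⌋₊ := by have := a.2; omega
    have h2 : (a : ℝ) ≤ 2 * R / δ := by
      refine le_trans (b := ((⌊2 * R / δ⌋₊ : ℕ) : ℝ)) (by exact_mod_cast h1) (Nat.floor_le (by positivity))
    rwa [le_div_iff₀ hδ0] at h2)
  rw [Fintype.card_fin] at hcount
  have hle := htree.trans hcount
  have hD0 : 0 < D := by linarith
  have hlog := Real.log_le_log (by positivity) hle
  rw [Real.log_rpow (by linarith), Real.log_mul (by positivity) (by positivity),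
    Real.log_rpow hD0, Real.log_exp] at hlog
  have hfrac : (n : ℝ) * X / D ≤ Real.log m / (6 * p) := by
    rw [hD, div_le_div_iff₀ (by positivity) (by positivity)]
    have : (n : ℝ) * (6 * p * X) ≤ 10 * B * Real.log m * (6 * p * X) := by gcongr
    nlinarith
  have hmain : Real.log m ≤ 6 * p * (v * Real.log D) := by
    have e1 : 1 / (3 * p) * Real.log m - Real.log m / (6 * p) = Real.log m / (6 * p) := by
      field_simp; ring
    have e2 : Real.log m / (6 * p) ≤ v * Real.log D := by linarith
    rw [div_le_iff₀ (by positivity)] at e2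
    linarith
  have hXW : (X : ℝ) ≤ 2000 * W := by
    have := Nat.floor_le (a := 2 * R / δ) (by positivity)
    have e : 2 * R / δ = 1920 * W := by rw [hδ, hW]; field_simp; ring
    rw [e] at this
    rw [hX, e]; push_cast
    linarith
  have hlogD : Real.log D ≤ 24 * p * Real.log W := by
    have e1 : D ≤ 2 ^ 17 * p * W * B := by
      rw [hD]
      refine mul_le_mul_of_nonneg_right ?_ hB0.le
      have b1 := mul_le_mul_of_nonneg_left hXW hp0.le
      have b2 := mul_pos hp0 (by linarith : 0 < W)
      linarith
    have e2 := Real.log_le_log hD0 e1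
    have hW0 : 0 < W := by linarith
    have e2' : Real.log (2 ^ 17 * p * W * B) =
        17 * Real.log 2 + Real.log p + Real.log W + p * (Real.log 8 + Real.log W) := by
      rw [hB, Real.log_mul (by positivity) (by positivity),
        Real.log_mul (by positivity) (by positivity),
        Real.log_mul (by positivity) (by positivity), Real.log_rpow (by positivity),
        Real.log_mul (by positivity) (by positivity), Real.log_pow]
      norm_num
    rw [e2'] at e2
    have e3 := Real.log_le_sub_one_of_pos hp0
    have e4 := Real.log_le_log (by norm_num) hW2
    have e5 : Real.log 8 = 3 * Real.log 2 := by
      rw [show (8 : ℝ) = 2 ^ 3 by norm_num, Real.log_pow]; norm_num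
    rw [e5] at e2
    have e6 : p * (3 * Real.log 2 + Real.log W) ≤ p * (4 * Real.log W) := by
      gcongr; linarith
    have e7 : p * 0.69 ≤ p * Real.log W := by gcongr
    have e8 : Real.log W ≤ p * Real.log W :=
      le_mul_of_one_le_left (by linarith) hp
    linarith
  calc Real.log m ≤ 6 * p * (v * Real.log D) := hmain
    _ ≤ 6 * p * (v * (24 * p * Real.log W)) := by gcongr
    _ = _ := by ring


lemma weak_sep {Ω : Type} [Fintype Ω] (μ : Ω → ℝ) (p t : ℝ) (ht : 0 < t) (d : Ω → ℝ)
    (h : t ≤ lorentzNorm (fun s => s ^ p) μ d) :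
    ∃ u : ℝ, 0 < u ∧ (t / (2 * u)) ^ p < ∑ x ∈ Finset.univ.filter (fun x => u ≤ |d x|), μ x := by
  have hnot : ¬ (0 < t / 2 ∧ ∀ s : ℝ, 0 < s →
    ∑ x ∈ Finset.univ.filter (fun x => s ≤ |d x| / (t / 2)), μ x ≤ 1 / s ^ p) := by
    intro hmem
    have : lorentzNorm (fun s => s ^ p) μ d ≤ t / 2 :=
      csInf_le ⟨0, fun l hl => hl.1.le⟩ hmem
    linarith
  push Not at hnot
  obtain ⟨s, hs, hlt⟩ := hnot (by linarith)
  refine ⟨s * (t / 2), by positivity, ?_⟩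
  have e : t / (2 * (s * (t / 2))) = 1 / s := by field_simp
  rw [e, Real.div_rpow zero_le_one hs.le, Real.one_rpow]
  refine hlt.trans_le (le_of_eq (Finset.sum_congr (Finset.filter_congr fun x _ => ?_) fun _ _ => rfl))
  rw [le_div_iff₀ (by linarith)]

lemma weak_bdd {Ω : Type} [Fintype Ω] (μ : Ω → ℝ) (hμ : ∀ x, 0 ≤ μ x) (hμ1 : ∑ x, μ x = 1)
    (q : ℝ) (hq : 1 ≤ q) (f : Ω → ℝ)
    (h : lorentzNorm (fun s => s ^ q) μ f ≤ 1) (w : ℝ) (hw : 0 < w) :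
    ∑ x ∈ Finset.univ.filter (fun x => w ≤ |f x|), μ x ≤ (2 / w) ^ q := by
  have hne : {l : ℝ | 0 < l ∧ ∀ t : ℝ, 0 < t →
    ∑ x ∈ Finset.univ.filter (fun x => t ≤ |f x| / l), μ x ≤ 1 / t ^ q}.Nonempty := by
    have hs0 : 0 ≤ ∑ x, |f x| := Finset.sum_nonneg fun x _ => abs_nonneg _
    refine ⟨1 + ∑ x, |f x|, by linarith, fun t ht => ?_⟩
    by_cases ht1 : t ≤ 1
    · calc _ ≤ ∑ x, μ x := Finset.sum_le_sum_of_subset_of_nonneg (Finset.subset_univ _)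
            fun x _ _ => hμ x
        _ = 1 := hμ1
        _ ≤ 1 / t ^ q := by
          rw [le_div_iff₀ (by positivity), one_mul]
          exact Real.rpow_le_one ht.le ht1 (by linarith)
    · rw [Finset.filter_false_of_mem]
      · simp only [Finset.sum_empty]; positivity
      · intro x _ hx
        rw [le_div_iff₀ (by linarith)] at hx
        have := Finset.single_le_sum (f := fun x => |f x|) (fun x _ => abs_nonneg _)
          (Finset.mem_univ x)
        nlinarith
  obtain ⟨l, ⟨hl0, hl⟩, hl2⟩ := exists_lt_of_csInf_lt hne
    (lt_of_le_of_lt h (by norm_num : (1 : ℝ) < 2))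
  have h1 := hl (w / 2) (by positivity)
  have e : 1 / (w / 2) ^ q = (2 / w) ^ q := by
    rw [one_div, ← Real.inv_rpow (by positivity), inv_div]
  rw [e] at h1
  refine le_trans (Finset.sum_le_sum_of_subset_of_nonneg ?_ fun x _ _ => hμ x) h1
  intro x hx
  simp only [Finset.mem_filter, Finset.mem_univ, true_and] at hx ⊢
  rw [le_div_iff₀ hl0]
  nlinarith

lemma trunc_sep {Ω : Type} [Fintype Ω] (μ : Ω → ℝ) (hμ : ∀ x, 0 ≤ μ x)
    (p t R : ℝ) (hp : 1 ≤ p) (ht : 0 < t) (hR : 1 ≤ R) (f g : Ω → ℝ)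
    (hf : ∀ w, R ≤ w → 4 * ∑ x ∈ Finset.univ.filter (fun x => w ≤ |f x|), μ x ≤ (t / (4 * w)) ^ p)
    (hg : ∀ w, R ≤ w → 4 * ∑ x ∈ Finset.univ.filter (fun x => w ≤ |g x|), μ x ≤ (t / (4 * w)) ^ p)
    (h : t ≤ lorentzNorm (fun s => s ^ p) μ (f - g)) :
    (t / 4) ^ p ≤ ∑ x, μ x * |max (-R) (min R (f x)) - max (-R) (min R (g x))| ^ p := by
  obtain ⟨u, hu, hlt⟩ := weak_sep μ p t ht _ h
  have hp0 : 0 < p := by linarith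
  simp only [Pi.sub_apply] at hlt
  have huR : u < 2 * R := by
    by_contra hcon
    have hw : R ≤ u / 2 := by linarith
    have e1 := hf _ hw
    have e2 := hg _ hw
    have e : t / (4 * (u / 2)) = t / (2 * u) := by ring_nf
    rw [e] at e1 e2
    have e3 : ∑ x ∈ Finset.univ.filter (fun x => u ≤ |f x - g x|), μ x ≤
        ∑ x ∈ Finset.univ.filter (fun x => u / 2 ≤ |f x|), μ x +
        ∑ x ∈ Finset.univ.filter (fun x => u / 2 ≤ |g x|), μ x := by
      simp only [Finset.sum_filter]
      rw [← Finset.sum_add_distrib]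
      refine Finset.sum_le_sum fun x _ => ?_
      have a1 := abs_sub (f x) (g x)
      have a0 := hμ x
      split_ifs <;> linarith
    have : 0 < (t / (2 * u)) ^ p := by positivity
    linarith
  have e1 := hf R le_rfl
  have e2 := hg R le_rfl
  have e4 : (t / (4 * R)) ^ p ≤ (t / (2 * u)) ^ p := by
    refine Real.rpow_le_rpow (by positivity) ?_ hp0.le
    exact div_le_div_of_nonneg_left ht.le (by positivity) (by linarith)
  have e3 : u ^ p * ∑ x ∈ Finset.univ.filter (fun x => u ≤ |f x - g x|), μ x ≤
      u ^ p * (∑ x ∈ Finset.univ.filter (fun x => R ≤ |f x|), μ x +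
        ∑ x ∈ Finset.univ.filter (fun x => R ≤ |g x|), μ x) +
      ∑ x, μ x * |max (-R) (min R (f x)) - max (-R) (min R (g x))| ^ p := by
    simp only [Finset.sum_filter]
    rw [← Finset.sum_add_distrib, Finset.mul_sum, Finset.mul_sum, ← Finset.sum_add_distrib]
    refine Finset.sum_le_sum fun x _ => ?_
    have hup : 0 < u ^ p := by positivity
    have a0 := hμ x
    have a1 : 0 ≤ u ^ p * μ x := by positivity
    have a2 : 0 ≤ μ x * |max (-R) (min R (f x)) - max (-R) (min R (g x))| ^ p := by positivity
    by_cases c1 : R ≤ |f x|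
    · rw [if_pos c1]
      split_ifs <;> nlinarith
    by_cases c2 : R ≤ |g x|
    · rw [if_pos c2]
      split_ifs <;> nlinarith
    rw [if_neg c1, if_neg c2]
    split_ifs with c3
    · push Not at c1 c2
      rw [abs_lt] at c1 c2
      rw [min_eq_right c1.2.le, min_eq_right c2.2.le, max_eq_right c1.1.le, max_eq_right c2.1.le]
      have : u ^ p ≤ |f x - g x| ^ p := by gcongr
      nlinarith
    · simpa using a2
  have hup : 0 < u ^ p := by positivity
  have e5 : u ^ p * (t / (2 * u)) ^ p = (t / 2) ^ p := by
    rw [← Real.mul_rpow hu.le (by positivity)]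
    congr 1
    field_simp
  have e6 : (t / 4) ^ p ≤ (t / 2) ^ p / 2 := by
    have : (t / 4) ^ p = (t / 2) ^ p * (1 / 2) ^ p := by
      rw [← Real.mul_rpow (by positivity) (by norm_num)]; ring_nf
    rw [this, div_eq_mul_inv]
    refine mul_le_mul_of_nonneg_left ?_ (by positivity)
    calc (1 / 2 : ℝ) ^ p ≤ (1 / 2) ^ (1 : ℝ) :=
          Real.rpow_le_rpow_of_exponent_ge (by norm_num) (by norm_num) hp
      _ = 2⁻¹ := by norm_num
  have e7 := mul_le_mul_of_nonneg_left hlt.le hup.le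
  have e8 : u ^ p * (∑ x ∈ Finset.univ.filter (fun x => R ≤ |f x|), μ x +
        ∑ x ∈ Finset.univ.filter (fun x => R ≤ |g x|), μ x) ≤ u ^ p * ((t / (2 * u)) ^ p / 2) := by
    gcongr
    linarith
  have e9 : u ^ p * ((t / (2 * u)) ^ p / 2) = (t / 2) ^ p / 2 := by rw [← e5]; ring
  linarith

lemma tail_num (p q t w : ℝ) (hp : 1 ≤ p) (hpq : p < q) (ht : 0 < t) (ht2 : t < 1 / 2)
    (hw : (1 / t) ^ ((5 * p + q) / (q - p)) ≤ w) :
    4 * (2 / w) ^ q ≤ (t / (4 * w)) ^ p := by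
  have hqp : 0 < q - p := by linarith
  have hT : 2 ≤ 1 / t := by rw [le_div_iff₀ ht]; linarith
  have hw0 : 0 < w := lt_of_lt_of_le (by positivity) hw
  have h1 : (1 / t) ^ (5 * p + q) ≤ w ^ (q - p) := by
    calc (1 / t) ^ (5 * p + q) = ((1 / t) ^ ((5 * p + q) / (q - p))) ^ (q - p) := by
          rw [← Real.rpow_mul (by positivity)]
          congr 1
          field_simp
      _ ≤ w ^ (q - p) := by gcongr
  have h2 : 4 * 2 ^ q * 4 ^ p * (1 / t) ^ p ≤ (1 / t) ^ (5 * p + q) := by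
    have a1 : (4 : ℝ) ≤ (1 / t) ^ (2 * p) := by
      calc (4 : ℝ) = 2 ^ (2 : ℝ) := by norm_num
        _ ≤ 2 ^ (2 * p) := Real.rpow_le_rpow_of_exponent_le (by norm_num) (by linarith)
        _ ≤ _ := by gcongr
    have a2 : (4 : ℝ) ^ p ≤ (1 / t) ^ (2 * p) := by
      calc (4 : ℝ) ^ p = 2 ^ (2 * p) := by
            rw [Real.rpow_mul (by norm_num)]; norm_num
        _ ≤ _ := by gcongr
    have a3 : (2 : ℝ) ^ q ≤ (1 / t) ^ q :=
      Real.rpow_le_rpow (by norm_num) hT (by linarith)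
    calc 4 * 2 ^ q * 4 ^ p * (1 / t) ^ p
        ≤ (1 / t) ^ (2 * p) * (1 / t) ^ q * (1 / t) ^ (2 * p) * (1 / t) ^ p := by gcongr
      _ = (1 / t) ^ (5 * p + q) := by
          rw [← Real.rpow_add (by positivity), ← Real.rpow_add (by positivity),
            ← Real.rpow_add (by positivity)]
          ring_nf
  have h3 := h2.trans h1
  rw [Real.rpow_sub hw0, le_div_iff₀ (by positivity), Real.div_rpow zero_le_one ht.le,
    Real.one_rpow] at h3
  rw [Real.div_rpow (by norm_num) hw0.le, Real.div_rpow ht.le (by positivity),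
    Real.mul_rpow (by norm_num) hw0.le, mul_div_assoc', div_le_div_iff₀ (by positivity)
    (by positivity)]
  have htp : 0 < t ^ p := by positivity
  have e : 4 * 2 ^ q * 4 ^ p * (1 / t ^ p) * w ^ p = 4 * 2 ^ q * (4 ^ p * w ^ p) / t ^ p := by
    field_simp
  rw [e, div_le_iff₀ htp] at h3
  linarith

end EWL

open Classical in
/-- Let `1 ≤ p < q ≤ ∞` and let `F` be `1`-bounded in the weak space
`L_{q,∞}(Ω,μ)` on a finite probability space. Then for `0 < t < 1/2`,
`D(F, L_{p,∞}, t) ≤ C·(p²q/(q−p))·v(F, c t)·log(1/t)` (with `p²q/(q−p)` read as `p²`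
for `q = ∞`). -/
theorem entropy_weak_Lp_le_dimension :
    ∃ C > (0 : ℝ), ∃ c > (0 : ℝ),
      ∀ (Ω : Type) [Fintype Ω], ∀ (μ : Ω → ℝ) (p : ℝ) (q : ℝ≥0∞)
        (F : Set (Ω → ℝ)) (t : ℝ),
      (∀ x, 0 ≤ μ x) → (∑ x, μ x = 1) →
      1 ≤ p → ENNReal.ofReal p < q →
      (∀ f ∈ F, (q = ∞ → ∀ x, |f x| ≤ 1) ∧
        (q ≠ ∞ → lorentzNorm (fun s => s ^ q.toReal) μ f ≤ 1)) →
      0 < t → t < 1 / 2 →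
      entropyWrt (lorentzNorm (fun s => s ^ p) μ) F t ≤
        ENNReal.ofReal
          (C * (if q = ∞ then p ^ 2 else p ^ 2 * q.toReal / (q.toReal - p)) *
            (combDim F (c * t)).toReal * Real.log (1 / t)) := by
  refine ⟨1000, by norm_num, 1 / 960, by norm_num, ?_⟩
  intro Ω _ μ p q F t hμ hμ1 hp hpq hF ht ht2
  unfold entropyWrt
  refine iSup₂_le fun m hm => ?_
  obtain ⟨f, hf, hsep⟩ := hm
  apply ENNReal.ofReal_le_ofReal
  set v := (combDim F (1 / 960 * t)).toReal with hv
  have hv0 : 0 ≤ v := ENNReal.toReal_nonneg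
  have hfin : combDim F (1 / 960 * t) ≠ ∞ := by
    refine ne_top_of_le_ne_top (ENNReal.natCast_ne_top (Fintype.card Ω)) ?_
    refine iSup₂_le fun σ _ => ?_
    exact_mod_cast Finset.card_le_univ σ
  have hvσ : ∀ σ : Finset Ω, Shatters F (1 / 960 * t) σ → (σ.card : ℝ) ≤ v := by
    intro σ hσ
    have h1 : (σ.card : ℝ≥0∞) ≤ combDim F (1 / 960 * t) :=
      le_iSup₂ (f := fun (σ : Finset Ω) (_ : Shatters F (1 / 960 * t) σ) => (σ.card : ℝ≥0∞)) σ hσ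
    have h2 := ENNReal.toReal_mono hfin h1
    rwa [ENNReal.toReal_natCast] at h2
  have hT : 2 ≤ 1 / t := by rw [le_div_iff₀ ht]; linarith
  set L := Real.log (1 / t) with hL
  have hL2 : Real.log 2 ≤ L := Real.log_le_log (by norm_num) hT
  have hL0 : 0 < L := lt_of_lt_of_le (Real.log_pos (by norm_num)) hL2
  have hp0 : 0 < p := by linarith
  have hqr : q ≠ ∞ → p < q.toReal := fun hq => (ENNReal.ofReal_lt_iff_lt_toReal hp0.le hq).mp hpq
  have key : ∀ R : ℝ, 1 ≤ R → (∀ f ∈ F, ∀ w, R ≤ w →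
      4 * ∑ x ∈ Finset.univ.filter (fun x => w ≤ |f x|), μ x ≤ (t / (4 * w)) ^ p) →
      2 ≤ m → Real.log m ≤ 144 * p ^ 2 * v * Real.log (R / t) := by
    intro R hR htail hm
    refine EWL.core μ hμ hμ1 F m hm f hf p t R v hp ht ht2 hR hv0 hvσ ?_
    intro i j hij
    rcases lt_or_gt_of_ne hij with h | h
    · exact EWL.trunc_sep μ hμ p t R hp ht hR _ _ (by convert htail _ (hf i)) (by convert htail _ (hf j)) (hsep i j h)
    · have := EWL.trunc_sep μ hμ p t R hp ht hR _ _ (by convert htail _ (hf j)) (by convert htail _ (hf i)) (hsep j i h)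
      simpa only [abs_sub_comm] using this
  by_cases hm : 2 ≤ m
  swap
  · have h0 : Real.log m ≤ 0 := by
      apply Real.log_nonpos (by positivity)
      have : m ≤ 1 := by omega
      exact_mod_cast this
    refine h0.trans ?_
    have : 0 ≤ (if q = ∞ then p ^ 2 else p ^ 2 * q.toReal / (q.toReal - p)) := by
      split_ifs with hq
      · positivity
      · have := hqr hq
        have h1 : 0 < q.toReal - p := by linarith
        positivity
    positivity
  by_cases hq : q = ∞
  · rw [if_pos hq]
    have h1 := key 2 (by norm_num) (by
      intro f hf w hw
      rw [Finset.filter_false_of_mem]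
      · simp only [Finset.sum_empty, mul_zero]
        positivity
      · intro x _ hx
        have := (hF f hf).1 hq x
        linarith) hm
    have h2 : Real.log (2 / t) ≤ 2 * L := by
      rw [show 2 / t = 2 * (1 / t) by ring, Real.log_mul (by norm_num) (by positivity)]
      linarith
    calc Real.log m ≤ 144 * p ^ 2 * v * Real.log (2 / t) := h1
      _ ≤ 144 * p ^ 2 * v * (2 * L) := by gcongr
      _ ≤ 1000 * p ^ 2 * v * L := by
        have : 0 ≤ p ^ 2 * v * L := by positivity
        linarith
  · rw [if_neg hq]
    have hpq' := hqr hq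
    set Q := q.toReal with hQ
    have hQp : 0 < Q - p := by linarith
    have h1 := key ((1 / t) ^ ((5 * p + Q) / (Q - p)))
      (Real.one_le_rpow (by linarith) (by positivity)) (by
      intro f hf w hw
      have hw0 : 0 < w := lt_of_lt_of_le (by positivity) hw
      have a1 := EWL.weak_bdd μ hμ hμ1 Q (by linarith) f ((hF f hf).2 hq) w hw0
      have a2 := EWL.tail_num p Q t w hp hpq' ht ht2 hw
      refine le_trans ?_ a2
      gcongr) hm
    have h2 : Real.log ((1 / t) ^ ((5 * p + Q) / (Q - p)) / t) ≤ 6 * (Q / (Q - p)) * L := by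
      rw [div_eq_mul_one_div, Real.log_mul (by positivity) (by positivity),
        Real.log_rpow (by positivity)]
      have e : (5 * p + Q) / (Q - p) + 1 ≤ 6 * (Q / (Q - p)) := by
        rw [div_add_one hQp.ne', mul_div_assoc', div_le_div_iff_of_pos_right hQp]
        linarith
      nlinarith
    calc Real.log m ≤ 144 * p ^ 2 * v * Real.log ((1 / t) ^ ((5 * p + Q) / (Q - p)) / t) := h1
      _ ≤ 144 * p ^ 2 * v * (6 * (Q / (Q - p)) * L) := by gcongr
      _ = 864 * (p ^ 2 * Q / (Q - p) * v * L) := by ring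
      _ ≤ 1000 * (p ^ 2 * Q / (Q - p) * v * L) := by
        have : 0 ≤ p ^ 2 * Q / (Q - p) * v * L := by positivity
        linarith
      _ = _ := by ring
end

section
/- Let 1 ≤ p < q ≤ ∞, let (Ω,μ) be a finite probability space, and let F be a class of functions on Ω that is 1-bounded in L_q(Ω,μ). Then for all 0 < t < 1/2, D(F, L_p(Ω,μ), t) ≤ C_{p,q}·v(F, c_{p,q}·t)·log(1/(c_{p,q}·t)), where C_{p,q} = C·(p²q/(q−p)) and c_{p,q} = c·min(1, ((q−p)/p)^{1/p}), with C, c > 0 absolute constants (for q = ∞ interpret p²q/(q−p) as p² and ((q−p)/p)^{1/p} as suitable, so that c_{p,q} = c). -/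
open MeasureTheory Filter
open scoped ENNReal NNReal Pointwise BigOperators

/-- The `L_p` norm `(∫ |f|^p dμ)^{1/p}` on a finite probability space with weights `μ`. -/
noncomputable def lpNormFin {Ω : Type*} [Fintype Ω] (μ : Ω → ℝ) (p : ℝ) (f : Ω → ℝ) : ℝ :=
  (∑ x, μ x * |f x| ^ p) ^ (1 / p)



lemma aux_one_sided {α : Type*} (A : Finset α) (X : α → ℝ) (δ p M : ℝ) (hp : 1 ≤ p)
    (hM : ((A.filter (fun a => M < X a)).card : ℝ) ≤ A.card / 2)
    (H : ∀ th β : ℝ, 0 < β → β ≤ 1 / 2 →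
      (1 - β) * A.card ≤ (A.filter (fun a => X a ≤ th)).card →
      ((A.filter (fun a => th + δ ≤ X a)).card : ℝ) < β * A.card / 4 ^ p) (k : ℕ) :
    ((A.filter (fun a => M + k * δ < X a)).card : ℝ) ≤ A.card / 2 * (((4 : ℝ) ^ p)⁻¹) ^ k := by
  have h4 : (1 : ℝ) ≤ 4 ^ p := Real.one_le_rpow (by norm_num) (by linarith)
  have hinv : ((4 : ℝ) ^ p)⁻¹ ≤ 1 := inv_le_one_of_one_le₀ h4
  have hinv0 : 0 < ((4 : ℝ) ^ p)⁻¹ := by positivity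
  have hN : (0 : ℝ) ≤ A.card := Nat.cast_nonneg _
  induction k with
  | zero => simpa using hM
  | succ k ih =>
    set b := ((A.filter (fun a => M + k * δ < X a)).card : ℝ) with hb
    have hb2 : b ≤ A.card / 2 := by
      refine ih.trans ?_
      have := pow_le_one₀ hinv0.le hinv (n := k)
      nlinarith
    have hb0 : 0 ≤ b := Nat.cast_nonneg _
    have key : ((A.filter (fun a => M + (k + 1 : ℕ) * δ < X a)).card : ℝ) ≤ b * ((4 : ℝ) ^ p)⁻¹ := by
      rcases hb0.eq_or_lt with h0 | h0
      · by_cases hδ : 0 ≤ δ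
        · have : ((A.filter (fun a => M + (k + 1 : ℕ) * δ < X a)).card : ℝ) ≤ b := by
            rw [hb]
            norm_cast
            apply Finset.card_le_card
            intro a ha
            simp only [Finset.mem_filter] at ha ⊢
            refine ⟨ha.1, ?_⟩
            have := ha.2
            push_cast at this
            nlinarith
          rw [← h0] at this ⊢
          simpa using this
        · have hs : (A.filter (fun a => M + (k + 1 : ℕ) * δ < X a)).card ≤ (A.filter (fun a => M + k * δ + δ ≤ X a)).card := by
            apply Finset.card_le_card
            intro a ha
            simp only [Finset.mem_filter] at ha ⊢
            refine ⟨ha.1, ?_⟩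
            have := ha.2
            push_cast at this
            nlinarith
          rw [← h0]
          by_contra hcon
          push Not at hcon
          have hNp : (0:ℝ) < A.card := by
            have : ((A.filter (fun a => M + (k + 1 : ℕ) * δ < X a)).card : ℝ) ≤ A.card := by
              exact_mod_cast Finset.card_filter_le _ _
            linarith
          have hle : A.card ≤ (A.filter (fun a => X a ≤ M + k * δ)).card := by
            have := Finset.card_filter_add_card_filter_not (s := A) (fun a => M + k * δ < X a)
            have h00 : (A.filter (fun a => M + k * δ < X a)).card = 0 := by
              have := hb.symm.trans h0.symm
              exact_mod_cast this
            simp only [not_lt] at this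
            omega
          -- all X a ≤ M + kδ but some X a > M+(k+1)δ; take small β
          have h1 : (1:ℝ) ≤ (A.filter (fun a => M + k * δ + δ ≤ X a)).card := by
            have : (0:ℝ) < (A.filter (fun a => M + k * δ + δ ≤ X a)).card := by
              have : ((A.filter (fun a => M + (k + 1 : ℕ) * δ < X a)).card : ℝ) ≤ (A.filter (fun a => M + k * δ + δ ≤ X a)).card := by exact_mod_cast hs
              linarith
            exact_mod_cast this
          have := H (M + k * δ) (min (1/2) (1 / A.card)) (by positivity) (min_le_left _ _) (by
            have h2 : (0:ℝ) < min (1/2) (1 / (A.card:ℝ)) := by positivity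
            have h3 : (A.card : ℝ) ≤ (A.filter (fun a => X a ≤ M + k * δ)).card := by exact_mod_cast hle
            nlinarith)
          have h5 : min (1/2) (1 / (A.card:ℝ)) * A.card / 4 ^ p ≤ 1 := by
            rw [div_le_one (by positivity)]
            refine le_trans ?_ h4
            calc _ ≤ 1 / (A.card:ℝ) * A.card := by gcongr; exact min_le_right _ _
              _ = 1 := by field_simp
          linarith
      · have hNp : (0 : ℝ) < A.card := by linarith
        have h1 := H (M + k * δ) (b / A.card) (by positivity)
          (by rw [div_le_iff₀ hNp]; linarith) (by
            have := Finset.card_filter_add_card_filter_not (s := A) (fun a => M + k * δ < X a)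
            simp only [not_lt] at this
            have h3 : b + ((A.filter (fun a => X a ≤ M + k * δ)).card : ℝ) = A.card := by
              rw [hb]; exact_mod_cast this
            have : (1 - b / A.card) * A.card = A.card - b := by field_simp
            linarith)
        have h2 : b / A.card * A.card / 4 ^ p = b * ((4 : ℝ) ^ p)⁻¹ := by field_simp
        rw [h2] at h1
        refine le_trans ?_ h1.le
        norm_cast
        apply Finset.card_le_card
        intro a ha
        simp only [Finset.mem_filter] at ha ⊢
        refine ⟨ha.1, ?_⟩
        have := ha.2
        push_cast at this
        nlinarith
    calc _ ≤ _ := key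
      _ ≤ A.card / 2 * (((4 : ℝ) ^ p)⁻¹) ^ k * ((4 : ℝ) ^ p)⁻¹ := by gcongr
      _ = _ := by rw [pow_succ]; ring

lemma aux_median {α : Type*} (A : Finset α) (hA : A.Nonempty) (X : α → ℝ) :
    ∃ M : ℝ, ((A.filter (fun a => M < X a)).card : ℝ) ≤ A.card / 2 ∧
      ((A.filter (fun a => X a < M)).card : ℝ) ≤ A.card / 2 := by
  classical
  obtain ⟨a0, ha0, hmax⟩ := A.exists_max_image X hA
  set B := A.filter (fun b => 2 * (A.filter (fun a => X b < X a)).card ≤ A.card) with hB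
  have hBne : B.Nonempty := by
    refine ⟨a0, ?_⟩
    simp only [hB, Finset.mem_filter]
    refine ⟨ha0, ?_⟩
    rw [Finset.filter_false_of_mem]
    · simp
    · intro a ha; exact not_lt.mpr (hmax a ha)
  obtain ⟨m, hm, hmin⟩ := B.exists_min_image X hBne
  have hm' := (Finset.mem_filter.mp hm)
  refine ⟨X m, ?_, ?_⟩
  · have : (2 * (A.filter (fun a => X m < X a)).card : ℝ) ≤ A.card := by exact_mod_cast hm'.2
    linarith
  · rcases (A.filter (fun a => X a < X m)).eq_empty_or_nonempty with h | h
    · rw [h]; simp; positivity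
    · obtain ⟨c, hc, hcmax⟩ := Finset.exists_max_image _ X h
      have hc' := Finset.mem_filter.mp hc
      have hcB : c ∉ B := fun hcB => absurd (hmin c hcB) (not_le.mpr hc'.2)
      have h2 : A.card < 2 * (A.filter (fun a => X c < X a)).card := by
        by_contra hcon
        exact hcB (Finset.mem_filter.mpr ⟨hc'.1, not_lt.mp hcon⟩)
      have hdis : Disjoint (A.filter (fun a => X c < X a)) (A.filter (fun a => X a < X m)) := by
        rw [Finset.disjoint_left]
        intro a ha hb
        exact absurd (hcmax a hb) (not_le.mpr (Finset.mem_filter.mp ha).2)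
      have h3 := Finset.card_le_card (Finset.union_subset (Finset.filter_subset (fun a => X c < X a) A) (Finset.filter_subset (fun a => X a < X m) A))
      rw [Finset.card_union_of_disjoint hdis] at h3
      have h4 : 2 * (A.filter (fun a => X a < X m)).card ≤ A.card := by omega
      have : (2 * (A.filter (fun a => X a < X m)).card : ℝ) ≤ A.card := by exact_mod_cast h4
      linarith

lemma aux_moment {α : Type*} (A : Finset α) (Y : α → ℝ) (hY : ∀ a ∈ A, 0 ≤ Y a)
    (δ p : ℝ) (hδ : 0 < δ) (hp : 1 ≤ p)
    (h : ∀ k : ℕ, ((A.filter (fun a => k * δ < Y a)).card : ℝ) ≤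
      A.card * (((4 : ℝ) ^ p)⁻¹) ^ k) :
    ∑ a ∈ A, Y a ^ p ≤ 2 * A.card * δ ^ p := by
  classical
  obtain ⟨J, hJ⟩ : ∃ J : ℕ, ∀ a ∈ A, Y a / δ ≤ J := by
    obtain ⟨R, hR⟩ := (A.image (fun a => Y a / δ)).finite_toSet.bddAbove
    obtain ⟨J, hJ⟩ := exists_nat_ge R
    exact ⟨J, fun a ha => (hR (by simpa using ⟨a, ha, rfl⟩)).trans hJ⟩
  have hpt : ∀ a ∈ A, Y a ^ p ≤ ∑ k ∈ Finset.range J,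
      (if k * δ < Y a then (((k : ℝ) + 1) * δ) ^ p else 0) := by
    intro a ha
    have hnn : ∀ k ∈ Finset.range J, (0:ℝ) ≤ (if k * δ < Y a then (((k : ℝ) + 1) * δ) ^ p else 0) := by
      intro k _; split_ifs <;> positivity
    rcases (hY a ha).eq_or_lt with h0 | h0
    · rw [← h0, Real.zero_rpow (by linarith)]
      rw [← h0] at hnn
      exact Finset.sum_nonneg hnn
    · have hq : 0 < Y a / δ := by positivity
      have hc : 0 < ⌈Y a / δ⌉₊ := Nat.ceil_pos.mpr hq
      obtain ⟨k, hk⟩ : ∃ k, ⌈Y a / δ⌉₊ = k + 1 := ⟨_, (Nat.succ_pred_eq_of_pos hc).symm⟩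
      have hkJ : k < J := by
        have : ⌈Y a / δ⌉₊ ≤ J := Nat.ceil_le.mpr (hJ a ha)
        omega
      have hk1 : (k : ℝ) * δ < Y a := by
        rw [← lt_div_iff₀ hδ]
        apply Nat.lt_ceil.mp; omega
      have hk2 : Y a ≤ ((k : ℝ) + 1) * δ := by
        rw [← div_le_iff₀ hδ]
        have := Nat.le_ceil (Y a / δ)
        rw [hk] at this; exact_mod_cast this
      refine le_trans ?_ (Finset.single_le_sum hnn (Finset.mem_range.mpr hkJ))
      rw [if_pos hk1]
      exact Real.rpow_le_rpow h0.le hk2 (by linarith)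
  calc ∑ a ∈ A, Y a ^ p ≤ ∑ a ∈ A, ∑ k ∈ Finset.range J,
        (if k * δ < Y a then (((k : ℝ) + 1) * δ) ^ p else 0) := Finset.sum_le_sum hpt
    _ = ∑ k ∈ Finset.range J, ((A.filter (fun a => k * δ < Y a)).card : ℝ) * (((k : ℝ) + 1) * δ) ^ p := by
        rw [Finset.sum_comm]
        refine Finset.sum_congr rfl fun k _ => ?_
        rw [← Finset.sum_filter, Finset.sum_const, nsmul_eq_mul]
    _ ≤ ∑ k ∈ Finset.range J, (A.card * δ ^ p) * (1 / 2 : ℝ) ^ k := by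
        refine Finset.sum_le_sum fun k _ => ?_
        calc _ ≤ A.card * (((4 : ℝ) ^ p)⁻¹) ^ k * (((k : ℝ) + 1) * δ) ^ p := by
              gcongr; exact h k
          _ = (A.card * δ ^ p) * ((((k:ℝ)+1) / 4 ^ k) ^ p) := by
              rw [Real.mul_rpow (by positivity) hδ.le, Real.div_rpow (by positivity) (by positivity),
                inv_pow, ← Real.rpow_natCast, ← Real.rpow_mul (by norm_num), ← Real.rpow_natCast,
                ← Real.rpow_mul (by norm_num), mul_comm p]
              ring
          _ ≤ (A.card * δ ^ p) * (((1/2:ℝ)^k) ^ p) := by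
              gcongr
              rw [div_le_iff₀ (by positivity), ← mul_pow]
              have : (k:ℝ) + 1 ≤ 2 ^ k := by exact_mod_cast Nat.lt_two_pow_self
              norm_num at this ⊢; exact this
          _ ≤ (A.card * δ ^ p) * (1/2:ℝ)^k := by
              gcongr
              conv_rhs => rw [← Real.rpow_one ((1/2:ℝ)^k)]
              exact Real.rpow_le_rpow_of_exponent_ge (by positivity) (pow_le_one₀ (by norm_num) (by norm_num)) hp
    _ = (A.card * δ ^ p) * ∑ k ∈ Finset.range J, (1 / 2 : ℝ) ^ k := by rw [Finset.mul_sum]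
    _ ≤ (A.card * δ ^ p) * 2 := by
        gcongr
        exact sum_geometric_two_le J
    _ = _ := by ring

lemma aux_split {α : Type*} (A : Finset α) (hA : A.Nonempty) (X : α → ℝ) (t p : ℝ)
    (ht : 0 < t) (hp : 1 ≤ p)
    (hX : (A.card : ℝ) ^ 2 * t ^ p / 8 ≤ ∑ a ∈ A, ∑ b ∈ A, |X a - X b| ^ p) :
    ∃ th β : ℝ, 0 < β ∧ β ≤ 1 / 2 ∧
      (((1 - β) * A.card ≤ (A.filter (fun a => X a ≤ th)).card ∧
        β * A.card / 4 ^ p ≤ ((A.filter (fun a => th + t / 128 ≤ X a)).card : ℝ)) ∨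
       ((1 - β) * A.card ≤ (A.filter (fun a => th + t / 128 ≤ X a)).card ∧
        β * A.card / 4 ^ p ≤ ((A.filter (fun a => X a ≤ th)).card : ℝ))) := by
  classical
  by_contra hcon
  push Not at hcon
  obtain ⟨M, hM1, hM2⟩ := aux_median A hA X
  have hδ : 0 < t / 128 := by positivity
  have u1 := aux_one_sided A X (t / 128) p M hp hM1
    (fun th β h0 h1 h2 => (hcon th β h0 h1).1 h2)
  have u2 := aux_one_sided A (fun a => - X a) (t / 128) p (-M) hp
    (by simpa using hM2)
    (fun th β h0 h1 h2 => by
      have := (hcon (-th - t / 128) β h0 h1).2 (by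
        convert h2 using 4
        constructor <;> intro <;> linarith)
      rw [show A.filter (fun a => th + t / 128 ≤ - X a) = A.filter (fun a => X a ≤ -th - t / 128) from
        Finset.filter_congr fun a _ => by constructor <;> intro h <;> linarith]
      exact this)
  have hmom := aux_moment A (fun a => |X a - M|) (fun a _ => abs_nonneg _) (t / 128) p hδ hp (by
    intro k
    have : (A.filter (fun a => k * (t / 128) < |X a - M|)).card ≤
        (A.filter (fun a => M + k * (t / 128) < X a)).card +
        (A.filter (fun a => -M + k * (t / 128) < - X a)).card := by
      refine le_trans (Finset.card_le_card ?_) (Finset.card_union_le _ _)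
      intro a ha
      simp only [Finset.mem_union, Finset.mem_filter] at ha ⊢
      rcases lt_abs.mp ha.2 with h | h
      · left; exact ⟨ha.1, by linarith⟩
      · right; exact ⟨ha.1, by linarith⟩
    have h' : ((A.filter (fun a => k * (t / 128) < |X a - M|)).card : ℝ) ≤
        (A.filter (fun a => M + k * (t / 128) < X a)).card +
        (A.filter (fun a => -M + k * (t / 128) < - X a)).card := by exact_mod_cast this
    linarith [u1 k, u2 k])
  have hpt : ∀ a b, |X a - X b| ^ p ≤ 2 ^ p * (|X a - M| ^ p + |X b - M| ^ p) := by
    intro a b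
    have h1 : |X a - X b| ≤ 2 * max (|X a - M|) (|X b - M|) := by
      have : |X a - X b| ≤ |X a - M| + |X b - M| := by
        rw [abs_sub_comm (X b) M]; exact abs_sub_le _ _ _
      linarith [le_max_left (|X a - M|) (|X b - M|), le_max_right (|X a - M|) (|X b - M|)]
    have h2 := Real.rpow_le_rpow (abs_nonneg _) h1 (by linarith : 0 ≤ p)
    rw [Real.mul_rpow (by norm_num) (by positivity)] at h2
    refine h2.trans ?_
    gcongr
    have e1 : 0 ≤ |X a - M| ^ p := by positivity
    have e2 : 0 ≤ |X b - M| ^ p := by positivity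
    rcases max_choice (|X a - M|) (|X b - M|) with h | h <;> rw [h] <;> linarith
  have hN : (0 : ℝ) < A.card := by exact_mod_cast hA.card_pos
  have hsum : ∑ a ∈ A, ∑ b ∈ A, |X a - X b| ^ p ≤
      2 ^ p * (2 * A.card * ∑ a ∈ A, |X a - M| ^ p) := by
    calc _ ≤ ∑ a ∈ A, ∑ b ∈ A, 2 ^ p * (|X a - M| ^ p + |X b - M| ^ p) :=
          Finset.sum_le_sum fun a _ => Finset.sum_le_sum fun b _ => hpt a b
      _ = _ := by
          simp only [← Finset.mul_sum, Finset.sum_add_distrib, Finset.sum_const, nsmul_eq_mul]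
          ring
  have htp : 0 < t ^ p := by positivity
  have h64 : (2:ℝ) ^ p * (t / 128) ^ p ≤ t ^ p / 64 := by
    rw [← Real.mul_rpow (by norm_num) hδ.le, show 2 * (t / 128) = t / 64 by ring,
      Real.div_rpow ht.le (by norm_num)]
    gcongr
    conv_lhs => rw [← Real.rpow_one 64]
    exact Real.rpow_le_rpow_of_exponent_le (by norm_num) hp
  have : (A.card : ℝ) ^ 2 * t ^ p / 8 ≤ A.card ^ 2 * t ^ p / 16 := by
    calc _ ≤ _ := hX
      _ ≤ _ := hsum
      _ ≤ 2 ^ p * (2 * A.card * (2 * A.card * (t/128) ^ p)) := by gcongr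
      _ = 4 * A.card ^ 2 * (2 ^ p * (t/128) ^ p) := by ring
      _ ≤ 4 * A.card ^ 2 * (t ^ p / 64) := by gcongr
      _ = _ := by ring
  have : 0 < (A.card : ℝ) ^ 2 * t ^ p := by positivity
  linarith

def AuxSh {α ι : Type*} (v : α → ι → ℝ) (g : ℝ) (A : Finset α) (u : ι → Option ℤ) : Prop :=
  ∀ τ : Set ι, ∃ a ∈ A, ∀ x k, u x = some k →
    (x ∈ τ → g * k + g ≤ v a x) ∧ (x ∉ τ → v a x ≤ g * k)

open Classical in
noncomputable def auxS {α ι : Type*} [Fintype ι] (v : α → ι → ℝ) (g : ℝ) (L : ℕ)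
    (A : Finset α) : Finset (ι → Option ℤ) :=
  (Fintype.piFinset (fun _ : ι => Finset.insertNone (Finset.Icc (-(L : ℤ)) L))).filter
    (fun u => AuxSh v g A u)

lemma aux_mem_S {α ι : Type*} [Fintype ι] (v : α → ι → ℝ) (g : ℝ) (L : ℕ)
    (A : Finset α) (u : ι → Option ℤ) :
    u ∈ auxS v g L A ↔ (∀ x k, u x = some k → -(L : ℤ) ≤ k ∧ k ≤ L) ∧ AuxSh v g A u := by
  classical
  simp only [auxS, Finset.mem_filter, Fintype.mem_piFinset, Finset.mem_insertNone, Finset.mem_Icc,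
    Option.mem_def]

lemma aux_step {α ι : Type*} [Fintype ι] (v : α → ι → ℝ) (g : ℝ) (hg : 0 < g) (L : ℕ)
    (A B D : Finset α) (hB : B ⊆ A) (hD : D ⊆ A) (x : ι) (th : ℝ)
    (hBx : ∀ b ∈ B, v b x ≤ th) (hDx : ∀ b ∈ D, th + 2 * g ≤ v b x)
    (hth1 : -(L : ℝ) ≤ th / g) (hth2 : th / g ≤ L) :
    (auxS v g L B).card + (auxS v g L D).card ≤ (auxS v g L A).card := by
  classical
  have mono : ∀ E ⊆ A, auxS v g L E ⊆ auxS v g L A := by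
    intro E hE u hu
    rw [aux_mem_S] at hu ⊢
    refine ⟨hu.1, fun τ => ?_⟩
    obtain ⟨a, ha, h⟩ := hu.2 τ
    exact ⟨a, hE ha, h⟩
  set k : ℤ := ⌈th / g⌉ with hk
  have hk1 : th ≤ g * k := by
    have := Int.le_ceil (th / g)
    rw [div_le_iff₀ hg] at this
    rw [mul_comm]; exact this
  have hk2 : g * k < th + g := by
    have := Int.ceil_lt_add_one (th / g)
    have h2 := mul_lt_mul_of_pos_left this hg
    rw [mul_add, mul_div_cancel₀ _ hg.ne', mul_one] at h2
    exact h2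
  have hkL : -(L : ℤ) ≤ k ∧ k ≤ L := by
    constructor
    · have : (-(L : ℝ)) ≤ k := hth1.trans (Int.le_ceil _)
      exact_mod_cast this
    · exact Int.ceil_le.mpr (by exact_mod_cast hth2)
  have hnone : ∀ u ∈ auxS v g L B ∩ auxS v g L D, u x = none := by
    intro u hu
    rw [Finset.mem_inter, aux_mem_S, aux_mem_S] at hu
    cases hux : u x with
    | none => rfl
    | some j =>
      exfalso
      obtain ⟨a, ha, h⟩ := hu.1.2 Set.univ
      obtain ⟨b, hb, h'⟩ := hu.2.2 ∅
      have h1 := (h x j hux).1 (Set.mem_univ _)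
      have h2 := (h' x j hux).2 (Set.notMem_empty _)
      linarith [hBx a ha, hDx b hb]
  have hinj : Set.InjOn (fun u : ι → Option ℤ => Function.update u x (some k))
      (auxS v g L B ∩ auxS v g L D : Finset _) := by
    intro u hu w hw huw
    have h1 := hnone u hu
    have h2 := hnone w hw
    funext y
    by_cases hy : y = x
    · rw [hy, h1, h2]
    · have := congrFun huw y
      simpa [Function.update_of_ne hy] using this
  set I := (auxS v g L B ∩ auxS v g L D).image
    (fun u : ι → Option ℤ => Function.update u x (some k)) with hI
  have hIc : I.card = (auxS v g L B ∩ auxS v g L D).card := Finset.card_image_of_injOn hinj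
  have hIA : I ⊆ auxS v g L A := by
    intro w hw
    obtain ⟨u, hu, rfl⟩ := Finset.mem_image.mp hw
    rw [Finset.mem_inter, aux_mem_S, aux_mem_S] at hu
    rw [aux_mem_S]
    constructor
    · intro y j hj
      by_cases hy : y = x
      · subst hy
        simp at hj; rw [← hj]; exact hkL
      · rw [Function.update_of_ne hy] at hj; exact hu.1.1 y j hj
    · intro τ
      by_cases hx : x ∈ τ
      · obtain ⟨b, hb, h'⟩ := hu.2.2 τ
        refine ⟨b, hD hb, fun y j hj => ?_⟩
        by_cases hy : y = x
        · subst hy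
          simp at hj; rw [← hj]
          exact ⟨fun _ => by linarith [hDx b hb], fun h => absurd hx h⟩
        · rw [Function.update_of_ne hy] at hj; exact h' y j hj
      · obtain ⟨b, hb, h'⟩ := hu.1.2 τ
        refine ⟨b, hB hb, fun y j hj => ?_⟩
        by_cases hy : y = x
        · subst hy
          simp at hj; rw [← hj]
          exact ⟨fun h => absurd h hx, fun _ => by linarith [hBx b hb]⟩
        · rw [Function.update_of_ne hy] at hj; exact h' y j hj
  have hdis : Disjoint (auxS v g L B ∪ auxS v g L D) I := by
    rw [Finset.disjoint_right]
    intro w hw hw'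
    obtain ⟨u, hu, rfl⟩ := Finset.mem_image.mp hw
    rw [Finset.mem_union, aux_mem_S, aux_mem_S] at hw'
    rcases hw' with h | h
    · obtain ⟨a, ha, h⟩ := h.2 Set.univ
      have h1 := (h x k (by simp)).1 (Set.mem_univ _)
      linarith [hBx a ha]
    · obtain ⟨a, ha, h⟩ := h.2 ∅
      have h1 := (h x k (by simp)).2 (Set.notMem_empty _)
      linarith [hDx a ha]
  have h1 := Finset.card_le_card (Finset.union_subset (Finset.union_subset (mono B hB) (mono D hD)) hIA)
  rw [Finset.card_union_of_disjoint hdis, hIc, Finset.card_union_add_card_inter] at h1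
  exact h1

lemma aux_numeric (N b d β p : ℝ) (hN : 0 < N) (hp : 1 ≤ p) (hβ : 0 < β) (hβ2 : β ≤ 1 / 2)
    (hb : (1 - β) * N ≤ b) (hd : β * N / 4 ^ p ≤ d) :
    N ^ (1 / (2 * p)) ≤ b ^ (1 / (2 * p)) + d ^ (1 / (2 * p)) := by
  have hs : 0 < 1 / (2 * p) := by positivity
  have hs2 : 1 / (2 * p) ≤ 1 / 2 := by
    apply one_div_le_one_div_of_le <;> linarith
  have h1 : ((1 - β) * N) ^ (1 / (2 * p)) ≤ b ^ (1 / (2 * p)) :=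
    Real.rpow_le_rpow (by apply mul_nonneg <;> linarith) hb hs.le
  have h2 : (β * N / 4 ^ p) ^ (1 / (2 * p)) ≤ d ^ (1 / (2 * p)) :=
    Real.rpow_le_rpow (by positivity) hd hs.le
  have h3 : (β * N / 4 ^ p) ^ (1 / (2 * p)) = β ^ (1 / (2 * p)) * N ^ (1 / (2 * p)) / 2 := by
    rw [Real.div_rpow (by positivity) (by positivity), Real.mul_rpow hβ.le hN.le,
      ← Real.rpow_mul (by norm_num), show p * (1 / (2 * p)) = 1 / 2 by field_simp,
      ← Real.sqrt_eq_rpow, show (4:ℝ) = 2 ^ 2 by norm_num, Real.sqrt_sq (by norm_num)]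
  rw [Real.mul_rpow (by linarith) hN.le] at h1
  rw [h3] at h2
  have e1 : √(1 - β) ≤ (1 - β) ^ (1 / (2 * p)) := by
    rw [Real.sqrt_eq_rpow]
    exact Real.rpow_le_rpow_of_exponent_ge (by linarith) (by linarith) hs2
  have e2 : √β ≤ β ^ (1 / (2 * p)) := by
    rw [Real.sqrt_eq_rpow]
    exact Real.rpow_le_rpow_of_exponent_ge (by linarith) (by linarith) hs2
  have e3 : 1 ≤ √(1 - β) + √β / 2 := by
    have hu : √β ≤ 4 / 5 := by
      rw [Real.sqrt_le_left (by norm_num)]; linarith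
    have hu0 := Real.sqrt_nonneg β
    have hsq := Real.sq_sqrt hβ.le
    have : 1 - √β / 2 ≤ √(1 - β) := by
      apply Real.le_sqrt_of_sq_le
      nlinarith
    linarith
  have hN' : 0 < N ^ (1 / (2 * p)) := by positivity
  nlinarith

lemma aux_tree {α ι : Type*} [Fintype ι] [Nonempty ι] (v : α → ι → ℝ) (t p : ℝ)
    (ht : 0 < t) (hp : 1 ≤ p) (L : ℕ) (hL : 256 / t ≤ L)
    (bd : ∀ a x, |v a x| ≤ 1 / 2) (A : Finset α) (hA : A.Nonempty)
    (sep : ∀ a ∈ A, ∀ b ∈ A, a ≠ b → (Fintype.card ι : ℝ) * t ^ p / 4 ≤ ∑ x, |v a x - v b x| ^ p) :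
    (A.card : ℝ) ^ (1 / (2 * p)) ≤ (auxS v (t / 256) L A).card := by
  classical
  induction A using Finset.strongInduction with
  | H A ih =>
  have hg : 0 < t / 256 := by positivity
  rcases Nat.lt_or_ge A.card 2 with hc | hc
  · have h1 : A.card = 1 := by have := hA.card_pos; omega
    rw [h1]
    simp only [Nat.cast_one, Real.one_rpow, Nat.one_le_cast]
    apply Finset.card_pos.mpr
    refine ⟨fun _ => none, ?_⟩
    rw [aux_mem_S]
    refine ⟨by simp, fun τ => ?_⟩
    obtain ⟨a, ha⟩ := hA
    exact ⟨a, ha, by simp⟩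
  · have hN2 : (2 : ℝ) ≤ A.card := by exact_mod_cast hc
    have htp : 0 < t ^ p := by positivity
    have hn : (0:ℝ) < Fintype.card ι := by exact_mod_cast Fintype.card_pos
    obtain ⟨x, -, hx⟩ : ∃ x ∈ (Finset.univ : Finset ι), (A.card : ℝ) ^ 2 * t ^ p / 8 ≤
        ∑ a ∈ A, ∑ b ∈ A, |v a x - v b x| ^ p := by
      apply Finset.exists_le_of_sum_le Finset.univ_nonempty
      have e1 : ∑ x : ι, ∑ a ∈ A, ∑ b ∈ A, |v a x - v b x| ^ p =
          ∑ a ∈ A, ∑ b ∈ A, ∑ x : ι, |v a x - v b x| ^ p := by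
        rw [Finset.sum_comm]
        refine Finset.sum_congr rfl fun a _ => Finset.sum_comm
      rw [e1]
      have e2 : ∀ a ∈ A, ((A.card : ℝ) - 1) * (Fintype.card ι * t ^ p / 4) ≤
          ∑ b ∈ A, ∑ x : ι, |v a x - v b x| ^ p := by
        intro a ha
        calc ((A.card : ℝ) - 1) * (Fintype.card ι * t ^ p / 4)
            = ∑ b ∈ A.erase a, (Fintype.card ι * t ^ p / 4) := by
              rw [Finset.sum_const, nsmul_eq_mul, Finset.card_erase_of_mem ha,
                Nat.cast_sub (by omega), Nat.cast_one]
          _ ≤ ∑ b ∈ A.erase a, ∑ x : ι, |v a x - v b x| ^ p := by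
              refine Finset.sum_le_sum fun b hb => ?_
              exact sep a ha b (Finset.mem_of_mem_erase hb) (Finset.ne_of_mem_erase hb).symm
          _ ≤ _ := by
              apply Finset.sum_le_sum_of_subset_of_nonneg (Finset.erase_subset _ _)
              intro b _ _
              exact Finset.sum_nonneg fun x _ => by positivity
      have e3 := Finset.sum_le_sum e2
      refine le_trans ?_ e3
      simp only [Finset.sum_const, nsmul_eq_mul, Finset.card_univ]
      have : 0 < (Fintype.card ι : ℝ) * t ^ p * A.card := by positivity
      nlinarith
    obtain ⟨th, β, hβ0, hβ2, hsplit⟩ := aux_split A hA (fun a => v a x) t p ht hp hx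
    set B := A.filter (fun a => v a x ≤ th) with hB
    set D := A.filter (fun a => th + t / 128 ≤ v a x) with hD
    have hpos1 : 0 < (1 - β) * A.card := by apply mul_pos <;> linarith
    have hpos2 : 0 < β * A.card / 4 ^ p := by positivity
    have hBD : (0:ℝ) < B.card ∧ (0:ℝ) < D.card := by
      rcases hsplit with h | h
      · exact ⟨hpos1.trans_le h.1, hpos2.trans_le h.2⟩
      · exact ⟨hpos2.trans_le h.2, hpos1.trans_le h.1⟩
    have hBne : B.Nonempty := Finset.card_pos.mp (by exact_mod_cast hBD.1)
    have hDne : D.Nonempty := Finset.card_pos.mp (by exact_mod_cast hBD.2)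
    have hBA : B ⊆ A := Finset.filter_subset _ _
    have hDA : D ⊆ A := Finset.filter_subset _ _
    obtain ⟨b, hb⟩ := hBne
    obtain ⟨d, hd⟩ := hDne
    have hb' := (Finset.mem_filter.mp hb).2
    have hd' := (Finset.mem_filter.mp hd).2
    have hBs : B ⊂ A := by
      refine Finset.ssubset_iff_subset_ne.mpr ⟨hBA, fun h => ?_⟩
      have := hDA hd
      rw [← h] at this
      have := (Finset.mem_filter.mp this).2
      linarith
    have hDs : D ⊂ A := by
      refine Finset.ssubset_iff_subset_ne.mpr ⟨hDA, fun h => ?_⟩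
      have := hBA hb
      rw [← h] at this
      have := (Finset.mem_filter.mp this).2
      linarith
    have iB := ih B hBs ⟨b, hb⟩ (fun a ha c hc => sep a (hBA ha) c (hBA hc))
    have iD := ih D hDs ⟨d, hd⟩ (fun a ha c hc => sep a (hDA ha) c (hDA hc))
    have hbx := abs_le.mp (bd b x)
    have hdx := abs_le.mp (bd d x)
    have hL' : (256 : ℝ) ≤ L * t := by rwa [div_le_iff₀ ht] at hL
    have hst := aux_step v (t / 256) hg L A B D hBA hDA x th
      (fun b hb => (Finset.mem_filter.mp hb).2)
      (fun b hb => by have := (Finset.mem_filter.mp hb).2; linarith)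
      (by rw [le_div_iff₀ hg]; nlinarith) (by rw [div_le_iff₀ hg]; nlinarith)
    have hst' : ((auxS v (t / 256) L B).card : ℝ) + (auxS v (t / 256) L D).card ≤
      (auxS v (t / 256) L A).card := by exact_mod_cast hst
    refine le_trans ?_ hst'
    refine le_trans ?_ (add_le_add iB iD)
    rcases hsplit with h | h
    · exact aux_numeric _ _ _ β p (by linarith) hp hβ0 hβ2 h.1 h.2
    · rw [add_comm]
      exact aux_numeric _ _ _ β p (by linarith) hp hβ0 hβ2 h.1 h.2

lemma aux_count {α ι : Type*} [Fintype ι] (v : α → ι → ℝ) (g : ℝ) (L : ℕ) (A : Finset α)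
    (d : ℕ) (y : ℝ) (hy : 0 < y) (hy1 : y ≤ 1)
    (hd : ∀ u ∈ auxS v g L A, (Finset.univ.filter (fun x => u x ≠ none)).card ≤ d) :
    ((auxS v g L A).card : ℝ) * y ^ d ≤ Real.exp (Fintype.card ι * ((2 * L + 1) * y)) := by
  classical
  let w : Option ℤ → ℝ := fun o => if o = none then 1 else y
  have hw0 : ∀ o, 0 ≤ w o := by intro o; simp only [w]; split_ifs <;> linarith
  calc ((auxS v g L A).card : ℝ) * y ^ d = ∑ u ∈ auxS v g L A, y ^ d := by
        rw [Finset.sum_const, nsmul_eq_mul]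
    _ ≤ ∑ u ∈ auxS v g L A, ∏ x, w (u x) := by
        refine Finset.sum_le_sum fun u hu => ?_
        have : ∏ x, w (u x) = y ^ (Finset.univ.filter (fun x => u x ≠ none)).card := by
          simp only [w]
          rw [Finset.prod_ite]
          simp
        rw [this]
        exact pow_le_pow_of_le_one hy.le hy1 (hd u hu)
    _ ≤ ∑ u ∈ Fintype.piFinset (fun _ : ι => Finset.insertNone (Finset.Icc (-(L : ℤ)) L)),
          ∏ x, w (u x) := by
        apply Finset.sum_le_sum_of_subset_of_nonneg (Finset.filter_subset _ _)
        intro u _ _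
        exact Finset.prod_nonneg fun x _ => hw0 _
    _ = ∏ x : ι, ∑ o ∈ Finset.insertNone (Finset.Icc (-(L : ℤ)) L), w o := by
        rw [Finset.prod_univ_sum]
    _ = (1 + (2 * L + 1) * y) ^ Fintype.card ι := by
        rw [Finset.prod_const, Finset.card_univ]
        congr 1
        rw [Finset.sum_insertNone]
        simp only [w]
        simp
        left
        have : ((L:ℤ) + 1 + L).toNat = 2 * L + 1 := by omega
        rw [this]; push_cast; ring
    _ ≤ (Real.exp ((2 * L + 1) * y)) ^ Fintype.card ι := by
        gcongr
        rw [add_comm]; exact Real.add_one_le_exp _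
    _ = _ := by rw [← Real.exp_nat_mul]

lemma aux_extract {Ω P : Type*} [Fintype Ω] [Fintype P] (μ : Ω → ℝ) (hμ : ∀ x, 0 ≤ μ x)
    (hμ1 : ∑ x, μ x = 1) (Z : P → Ω → ℝ) (hZ0 : ∀ P x, 0 ≤ Z P x) (hZ1 : ∀ P x, Z P x ≤ 1)
    (θ : ℝ) (hθ : ∀ P, θ ≤ ∑ x, μ x * Z P x) (n : ℕ) :
    ∃ ω : Fin n → Ω, ∀ P' : P,
      Real.exp (- ∑ i, Z P' (ω i)) ≤ Fintype.card P * Real.exp (- (n * (θ / 2))) := by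
  classical
  have hE : ∀ P', ∑ x, μ x * Real.exp (- Z P' x) ≤ Real.exp (-(θ / 2)) := by
    intro P'
    calc ∑ x, μ x * Real.exp (- Z P' x) ≤ ∑ x, μ x * (1 - Z P' x / 2) := by
          refine Finset.sum_le_sum fun x _ => mul_le_mul_of_nonneg_left ?_ (hμ x)
          have h0 := hZ0 P' x
          have h1 := hZ1 P' x
          rw [Real.exp_neg]
          have h2 := Real.add_one_le_exp (Z P' x)
          calc (Real.exp (Z P' x))⁻¹ ≤ (Z P' x + 1)⁻¹ := by gcongr
            _ ≤ _ := by
              rw [inv_le_iff_one_le_mul₀ (by positivity)]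
              nlinarith
      _ = 1 - (∑ x, μ x * Z P' x) / 2 := by
          simp only [mul_sub, Finset.sum_sub_distrib, mul_one, hμ1, Finset.sum_div]
          congr 1
          exact Finset.sum_congr rfl fun x _ => by ring
      _ ≤ -(θ / 2) + 1 := by linarith [hθ P']
      _ ≤ _ := Real.add_one_le_exp _
  by_contra hcon
  push Not at hcon
  set R := (Fintype.card P : ℝ) * Real.exp (- (n * (θ / 2))) with hR
  have hprod : ∀ φ : Ω → ℝ, ∑ ω : Fin n → Ω, ∏ i, φ (ω i) = (∑ x, φ x) ^ n := by
    intro φ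
    rw [← Fintype.piFinset_univ, ← Finset.prod_univ_sum (fun _ : Fin n => Finset.univ) (fun _ x => φ x)]
    simp
  have htot : ∑ ω : Fin n → Ω, ∏ i, μ (ω i) = 1 := by rw [hprod, hμ1, one_pow]
  have hup : ∑ ω : Fin n → Ω, (∏ i, μ (ω i)) * ∑ P', Real.exp (- ∑ i, Z P' (ω i)) ≤ R := by
    calc _ = ∑ P', ∑ ω : Fin n → Ω, ∏ i, (μ (ω i) * Real.exp (- Z P' (ω i))) := by
          simp only [Finset.mul_sum]
          rw [Finset.sum_comm]
          refine Finset.sum_congr rfl fun P' _ => Finset.sum_congr rfl fun ω _ => ?_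
          rw [Finset.prod_mul_distrib, ← Real.exp_sum, Finset.sum_neg_distrib]
      _ = ∑ P', (∑ x, μ x * Real.exp (- Z P' x)) ^ n := by
          refine Finset.sum_congr rfl fun P' _ => ?_
          rw [hprod (fun x => μ x * Real.exp (- Z P' x))]
      _ ≤ ∑ P' : P, (Real.exp (-(θ / 2))) ^ n := by
          refine Finset.sum_le_sum fun P' _ => ?_
          apply pow_le_pow_left₀ _ (hE P')
          exact Finset.sum_nonneg fun x _ => mul_nonneg (hμ x) (Real.exp_pos _).le
      _ = R := by
          rw [Finset.sum_const, nsmul_eq_mul, ← Real.exp_nat_mul, hR, Finset.card_univ]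
          congr 2; ring
  have hlow : R < ∑ ω : Fin n → Ω, (∏ i, μ (ω i)) * ∑ P', Real.exp (- ∑ i, Z P' (ω i)) := by
    have hin : ∀ ω : Fin n → Ω, R < ∑ P', Real.exp (- ∑ i, Z P' (ω i)) := by
      intro ω
      obtain ⟨P', hP'⟩ := hcon ω
      exact hP'.trans_le (Finset.single_le_sum (f := fun P' => Real.exp (- ∑ i, Z P' (ω i)))
        (fun _ _ => (Real.exp_pos _).le) (Finset.mem_univ P'))
    have hnn : ∀ ω : Fin n → Ω, 0 ≤ ∏ i, μ (ω i) := fun ω => Finset.prod_nonneg fun i _ => hμ _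
    calc R = ∑ ω : Fin n → Ω, (∏ i, μ (ω i)) * R := by rw [← Finset.sum_mul, htot, one_mul]
      _ < _ := by
        obtain ⟨ω, -, hω⟩ : ∃ ω ∈ (Finset.univ : Finset (Fin n → Ω)), 0 < ∏ i, μ (ω i) := by
          apply Finset.exists_lt_of_sum_lt
          simp [htot]
        apply Finset.sum_lt_sum
        · intro ω _
          exact mul_le_mul_of_nonneg_left (hin ω).le (hnn ω)
        · exact ⟨ω, Finset.mem_univ _, mul_lt_mul_of_pos_left (hin ω) hω⟩
  linarith

lemma aux_final (m n L d p t : ℝ) (hm : Real.log 2 ≤ Real.log m) (hp : 1 ≤ p) (ht : 0 < t)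
    (ht8 : t ≤ 1 / 8) (hd : 1 ≤ d) (hn0 : 0 < n) (hL0 : 0 < L)
    (hn : n ≤ 8 * Real.log m / t ^ p + 1) (hL : L ≤ 256 / t + 1)
    (h : 1 / (2 * p) * Real.log m ≤ d * (1 - Real.log (d / (n * (2 * L + 1))))) :
    Real.log m ≤ 36 * p ^ 2 * d * Real.log (1 / t) := by
  set l := Real.log (1 / t) with hl
  have hlt : Real.log t = - l := by rw [hl, one_div, Real.log_inv]; ring
  have hl2 : (2:ℝ) ≤ l := by
    have h8 : Real.log 8 ≤ l := by
      apply Real.log_le_log (by norm_num)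
      rw [le_div_iff₀ ht]; linarith
    have : Real.log 8 = 3 * Real.log 2 := by
      rw [show (8:ℝ) = 2 ^ 3 by norm_num, Real.log_pow]; norm_num
    have := Real.log_two_gt_d9
    linarith
  have hl8 : Real.log 32768 ≤ 5 * l := by
    have h8 : Real.log 8 ≤ l := by
      apply Real.log_le_log (by norm_num)
      rw [le_div_iff₀ ht]; linarith
    rw [show (32768:ℝ) = 8 ^ 5 by norm_num, Real.log_pow]; push_cast; linarith
  have hlm : 0.69 < Real.log m := by have := Real.log_two_gt_d9; linarith
  have htp : 0 < t ^ p := by positivity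
  have htp1 : t ^ p ≤ 1 := Real.rpow_le_one ht.le (by linarith) (by linarith)
  have hn' : n ≤ 16 * Real.log m / t ^ p := by
    refine hn.trans ?_
    have : 1 ≤ 8 * Real.log m / t ^ p := by rw [le_div_iff₀ htp]; linarith
    have e : 16 * Real.log m / t ^ p = 8 * Real.log m / t ^ p + 8 * Real.log m / t ^ p := by ring
    linarith
  have hL' : 2 * L + 1 ≤ 515 / t := by
    rw [le_div_iff₀ ht]
    have := mul_le_mul_of_nonneg_right hL ht.le
    rw [add_mul, div_mul_cancel₀ _ ht.ne'] at this
    nlinarith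
  set u := Real.log m / (2 * p * d) with hu
  have hu0 : 0 < u := by positivity
  have hmu : Real.log m = u * (2 * p * d) := by rw [hu]; field_simp
  have h1 : u ≤ 1 - Real.log (d / (n * (2 * L + 1))) := by
    have hd0 : 0 < d := by linarith
    have : 1 / (2 * p) * Real.log m = d * u := by rw [hmu]; field_simp
    rw [this] at h
    exact le_of_mul_le_mul_left h hd0
  have h2 : - Real.log (d / (n * (2 * L + 1))) ≤ Real.log (32768 * p * u / (t ^ p * t)) := by
    rw [← Real.log_inv, inv_div]
    apply Real.log_le_log (by positivity)
    rw [div_le_iff₀ (by positivity)]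
    calc n * (2 * L + 1) ≤ (16 * Real.log m / t ^ p) * (515 / t) := by gcongr
      _ = 16480 * p * u / (t ^ p * t) * d := by rw [hmu]; field_simp; norm_num
      _ ≤ _ := by gcongr; norm_num
  have h3 : Real.log (32768 * p * u / (t ^ p * t)) =
      Real.log 32768 + Real.log p + Real.log u + p * l + l := by
    rw [Real.log_div (by positivity) (by positivity), Real.log_mul (by positivity) (by positivity),
      Real.log_mul (by positivity) (by positivity), Real.log_mul (by positivity) (by positivity),
      Real.log_rpow ht, hlt]
    ring
  have h4 : Real.log p ≤ p := (Real.log_le_sub_one_of_pos (by linarith)).trans (by linarith)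
  have h5 : Real.log u ≤ u / 2 := by
    have e : u = 2 * (u / 2) := by ring
    have := Real.log_le_sub_one_of_pos (show 0 < u / 2 by positivity)
    rw [e, Real.log_mul (by norm_num) (by positivity)]
    have := Real.log_two_lt_d9
    linarith
  have h6 : u ≤ 18 * p * l := by nlinarith
  rw [hmu]
  calc u * (2 * p * d) ≤ (18 * p * l) * (2 * p * d) := by gcongr
    _ = _ := by ring

lemma aux_core {Ω : Type*} [Fintype Ω] (μ : Ω → ℝ) (hμ : ∀ x, 0 ≤ μ x)
    (hμ1 : ∑ x, μ x = 1) (m : ℕ) (hm : 2 ≤ m) (f : Fin m → Ω → ℝ) (p t : ℝ) (hp : 1 ≤ p)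
    (ht : 0 < t) (ht8 : t ≤ 1 / 8) (bd : ∀ i x, |f i x| ≤ 1 / 2)
    (sep : ∀ i j, i ≠ j → t ^ p ≤ ∑ x, μ x * |f i x - f j x| ^ p) :
    ∃ σ : Finset Ω, Shatters (Set.range f) (t / 256) σ ∧
      Real.log m ≤ 36 * p ^ 2 * σ.card * Real.log (1 / t) := by
  classical
  have htp : 0 < t ^ p := by positivity
  have hmR : (2:ℝ) ≤ m := by exact_mod_cast hm
  have hlm : Real.log 2 ≤ Real.log m := Real.log_le_log (by norm_num) hmR
  have hlm0 : 0 < Real.log m := lt_of_lt_of_le (Real.log_pos (by norm_num)) hlm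
  set n := ⌈8 * Real.log m / t ^ p⌉₊ with hn
  have hn0 : 0 < n := Nat.ceil_pos.mpr (by positivity)
  have hn1 : 8 * Real.log m ≤ n * t ^ p := by
    have := Nat.le_ceil (8 * Real.log m / t ^ p)
    rwa [div_le_iff₀ htp] at this
  have hn2 : (n : ℝ) ≤ 8 * Real.log m / t ^ p + 1 := (Nat.ceil_lt_add_one (by positivity)).le
  obtain ⟨ω, hω⟩ := aux_extract μ hμ hμ1
    (fun (P : {P : Fin m × Fin m // P.1 ≠ P.2}) x => |f P.1.1 x - f P.1.2 x| ^ p)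
    (fun P x => by positivity)
    (fun P x => by
      apply Real.rpow_le_one (abs_nonneg _) _ (by linarith)
      have h1 := abs_le.mp (bd P.1.1 x)
      have h2 := abs_le.mp (bd P.1.2 x)
      rw [abs_le]; constructor <;> linarith)
    (t ^ p) (fun P => sep _ _ P.2) n
  have hcard : (Fintype.card {P : Fin m × Fin m // P.1 ≠ P.2} : ℝ) ≤ (m : ℝ) ^ 2 := by
    have := Fintype.card_subtype_le (fun P : Fin m × Fin m => P.1 ≠ P.2)
    rw [Fintype.card_prod, Fintype.card_fin, ← sq] at this
    exact_mod_cast this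
  have : Nonempty (Fin n) := ⟨⟨0, hn0⟩⟩
  let v : Fin m → Fin n → ℝ := fun a i => f a (ω i)
  have hsep : ∀ a ∈ (Finset.univ : Finset (Fin m)), ∀ b ∈ (Finset.univ : Finset (Fin m)), a ≠ b →
      (Fintype.card (Fin n) : ℝ) * t ^ p / 4 ≤ ∑ i, |v a i - v b i| ^ p := by
    intro a _ b _ hab
    have h1 := hω ⟨(a, b), hab⟩
    have h2 : Real.exp (- ∑ i, |v a i - v b i| ^ p) ≤
        Real.exp (2 * Real.log m + - (n * (t ^ p / 2))) := by
      rw [Real.exp_add, show (2:ℝ) * Real.log m = ((2:ℕ):ℝ) * Real.log m by norm_num,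
        Real.exp_nat_mul, Real.exp_log (by linarith)]
      refine h1.trans ?_
      gcongr
    have h3 := Real.exp_le_exp.mp h2
    rw [Fintype.card_fin]
    linarith
  set L := ⌈256 / t⌉₊ with hL
  have hL0 : 0 < L := Nat.ceil_pos.mpr (by positivity)
  have hne : (Finset.univ : Finset (Fin m)).Nonempty := ⟨⟨0, by omega⟩, Finset.mem_univ _⟩
  have htree := aux_tree v t p ht hp L (Nat.le_ceil _) (fun a i => bd a _) Finset.univ hne hsep
  rw [Finset.card_univ, Fintype.card_fin] at htree
  set S := auxS v (t / 256) L Finset.univ with hS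
  have hSne1 : 1 < S.card := by
    have : (1:ℝ) < (m:ℝ) ^ (1 / (2 * p)) := Real.one_lt_rpow (by linarith) (by positivity)
    exact_mod_cast this.trans_le htree
  have hSne : S.Nonempty := Finset.card_pos.mp (by omega)
  obtain ⟨u, huS, humax⟩ := Finset.exists_max_image S
    (fun u => (Finset.univ.filter (fun x => u x ≠ none)).card) hSne
  set s := Finset.univ.filter (fun x => u x ≠ none) with hs
  have huSh := ((aux_mem_S _ _ _ _ _).mp huS).2
  have hd0 : 0 < s.card := by
    by_contra hcon
    have h0 : s.card = 0 := by omega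
    have : S ⊆ {fun _ => none} := by
      intro w hw
      have := humax w hw
      rw [h0] at this
      have := Finset.card_eq_zero.mp (Nat.le_zero.mp this)
      rw [Finset.mem_singleton]
      funext x
      by_contra hx
      have : x ∈ Finset.univ.filter (fun x => w x ≠ none) := by simpa using hx
      simp_all
    have := Finset.card_le_card this
    simp at this
    omega
  have hsn : s.card ≤ n := by
    have := Finset.card_le_univ s
    rwa [Fintype.card_fin] at this
  have hg : 0 < t / 256 := by positivity
  have hinj : Set.InjOn ω s := by
    intro i hi j hj hij
    by_contra hne
    have hi' : u i ≠ none := by simpa [hs] using hi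
    have hj' : u j ≠ none := by simpa [hs] using hj
    obtain ⟨k, hk⟩ := Option.ne_none_iff_exists'.mp hi'
    obtain ⟨l, hl⟩ := Option.ne_none_iff_exists'.mp hj'
    obtain ⟨a, -, ha⟩ := huSh {i}
    obtain ⟨b, -, hb⟩ := huSh {j}
    have a1 := (ha i k hk).1 rfl
    have a2 := (ha j l hl).2 (fun h => hne h.symm)
    have b1 := (hb j l hl).1 rfl
    have b2 := (hb i k hk).2 (fun h => hne h)
    simp only [v] at a1 a2 b1 b2
    rw [hij] at a1 b2
    linarith
  refine ⟨s.image ω, ?_, ?_⟩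
  · have hex : ∀ x : Ω, ∃ r : ℝ, x ∈ s.image ω → ∃ i k, u i = some k ∧ ω i = x ∧ r = t / 256 * (k:ℤ) := by
      intro x
      by_cases hx : x ∈ s.image ω
      · obtain ⟨i, hi, hix⟩ := Finset.mem_image.mp hx
        have hi' : u i ≠ none := by simpa [hs] using hi
        obtain ⟨k, hk⟩ := Option.ne_none_iff_exists'.mp hi'
        exact ⟨t / 256 * k, fun _ => ⟨i, k, hk, hix, rfl⟩⟩
      · exact ⟨0, fun h => absurd h hx⟩
    choose h hh using hex
    refine ⟨h, fun τ hτ => ?_⟩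
    obtain ⟨a, -, ha⟩ := huSh (ω ⁻¹' (τ : Set Ω))
    refine ⟨f a, ⟨a, rfl⟩, ?_, ?_⟩
    · intro x hx hxτ
      obtain ⟨i, k, hik, hix, hr⟩ := hh x hx
      have := (ha i k hik).2 (by simpa [hix] using hxτ)
      rw [hr, ← hix]; exact this
    · intro x hxτ
      obtain ⟨i, k, hik, hix, hr⟩ := hh x (hτ hxτ)
      have := (ha i k hik).1 (by simpa [hix] using hxτ)
      rw [hr, ← hix]; exact this
  · rw [Finset.card_image_of_injOn hinj]
    have hdR : (1:ℝ) ≤ s.card := by exact_mod_cast hd0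
    have hnR : (0:ℝ) < n := by exact_mod_cast hn0
    have hLR : (0:ℝ) < L := by exact_mod_cast hL0
    have hsnR : (s.card:ℝ) ≤ n := by exact_mod_cast hsn
    apply aux_final m n L s.card p t hlm hp ht ht8 hdR hnR hLR hn2
      (Nat.ceil_lt_add_one (by positivity)).le
    set y := (s.card : ℝ) / (n * (2 * L + 1)) with hy
    have hy0 : 0 < y := by positivity
    have hy1 : y ≤ 1 := by
      rw [hy, div_le_one (by positivity)]
      nlinarith
    have hc := aux_count v (t / 256) L Finset.univ s.card y hy0 hy1 humax
    rw [← hS, Fintype.card_fin, show (n:ℝ) * ((2 * L + 1) * y) = s.card by rw [hy]; field_simp] at hc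
    have hSR : (0:ℝ) < S.card := by exact_mod_cast (by omega : 0 < S.card)
    have h1 := Real.log_le_log (by positivity) hc
    rw [Real.log_mul (by positivity) (by positivity), Real.log_pow, Real.log_exp] at h1
    have h2 := Real.log_le_log (by positivity) htree
    rw [Real.log_rpow (by linarith)] at h2
    linarith

lemma aux_lp_add {Ω : Type*} [Fintype Ω] (μ : Ω → ℝ) (hμ : ∀ x, 0 ≤ μ x) (p : ℝ) (hp : 1 ≤ p)
    (f g : Ω → ℝ) : lpNormFin μ p (f + g) ≤ lpNormFin μ p f + lpNormFin μ p g := by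
  have key : ∀ h : Ω → ℝ, ∑ x, μ x * |h x| ^ p = ∑ x, |(μ x) ^ (1 / p) * h x| ^ p := by
    intro h
    refine Finset.sum_congr rfl fun x _ => ?_
    rw [abs_mul, Real.mul_rpow (abs_nonneg _) (abs_nonneg _),
      abs_of_nonneg (Real.rpow_nonneg (hμ x) _), ← Real.rpow_mul (hμ x),
      one_div_mul_cancel (by linarith), Real.rpow_one]
  have := Real.Lp_add_le Finset.univ (fun x => (μ x) ^ (1 / p) * f x)
    (fun x => (μ x) ^ (1 / p) * g x) hp
  unfold lpNormFin
  rw [key, key, key]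
  simpa only [Pi.add_apply, mul_add] using this

def auxTr {Ω : Type*} (M : ℝ) (f : Ω → ℝ) : Ω → ℝ := fun x => max (-M) (min M (f x))

lemma aux_reduce {Ω : Type*} [Fintype Ω] (μ : Ω → ℝ) (hμ : ∀ x, 0 ≤ μ x)
    (hμ1 : ∑ x, μ x = 1) (m : ℕ) (hm : 2 ≤ m) (f : Fin m → Ω → ℝ) (p t M : ℝ) (hp : 1 ≤ p)
    (ht : 0 < t) (ht2 : t < 1 / 2) (hM : 1 ≤ M)
    (sep : ∀ i j, i ≠ j → t / 2 ≤ lpNormFin μ p (auxTr M (f i) - auxTr M (f j))) :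
    ∃ σ : Finset Ω, Shatters (Set.range f) (t / 512) σ ∧
      Real.log m ≤ 36 * p ^ 2 * σ.card * Real.log (4 * M / t) := by
  have hM0 : 0 < M := by linarith
  obtain ⟨σ, hσ, hlog⟩ := aux_core μ hμ hμ1 m hm (fun i x => auxTr M (f i) x / (2 * M)) p
    (t / (4 * M)) hp (by positivity) (by
      rw [div_le_iff₀ (by positivity)]; linarith)
    (fun i x => by
      rw [abs_le, le_div_iff₀ (by positivity), div_le_iff₀ (by positivity)]
      simp only [auxTr]
      have h1 := le_max_left (-M) (min M (f i x))
      have h2 : max (-M) (min M (f i x)) ≤ M := max_le (by linarith) (min_le_left _ _)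
      constructor <;> linarith)
    (fun i j hij => by
      have h := sep i j hij
      unfold lpNormFin at h
      have hnn : 0 ≤ ∑ x, μ x * |(auxTr M (f i) - auxTr M (f j)) x| ^ p :=
        Finset.sum_nonneg fun x _ => mul_nonneg (hμ x) (by positivity)
      have h2 := Real.rpow_le_rpow (by positivity) h (by linarith : 0 ≤ p)
      rw [← Real.rpow_mul hnn, one_div_mul_cancel (by linarith), Real.rpow_one] at h2
      have e : ∑ x, μ x * |auxTr M (f i) x / (2 * M) - auxTr M (f j) x / (2 * M)| ^ p =
          (∑ x, μ x * |(auxTr M (f i) - auxTr M (f j)) x| ^ p) / (2 * M) ^ p := by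
        rw [Finset.sum_div]
        refine Finset.sum_congr rfl fun x _ => ?_
        rw [← sub_div, abs_div, abs_of_pos (by positivity : 0 < 2 * M),
          Real.div_rpow (abs_nonneg _) (by positivity), Pi.sub_apply, mul_div_assoc]
      rw [e, show t / (4 * M) = (t / 2) / (2 * M) by field_simp; norm_num,
        Real.div_rpow (by positivity) (by positivity)]
      gcongr)
  refine ⟨σ, ?_, ?_⟩
  · obtain ⟨h, hh⟩ := hσ
    have hgap : (h : Ω → ℝ) = h := rfl
    refine ⟨fun x => 2 * M * h x, fun τ hτ => ?_⟩
    have lo : ∀ x ∈ σ, -M ≤ 2 * M * h x := by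
      intro x hx
      obtain ⟨_, ⟨i, rfl⟩, h1, -⟩ := hh ∅ (Finset.empty_subset _)
      have := h1 x hx (by simp)
      simp only at this
      rw [div_le_iff₀ (by positivity)] at this
      have h3 := le_max_left (-M) (min M (f i x))
      simp only [auxTr] at this
      linarith
    have hi : ∀ x ∈ σ, 2 * M * h x + t / 512 ≤ M := by
      intro x hx
      obtain ⟨_, ⟨i, rfl⟩, -, h1⟩ := hh σ subset_rfl
      have := h1 x hx
      simp only at this
      rw [le_div_iff₀ (by positivity)] at this
      have h3 : max (-M) (min M (f i x)) ≤ M := max_le (by linarith) (min_le_left _ _)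
      simp only [auxTr] at this
      have e : (h x + t / (4 * M) / 256) * (2 * M) = 2 * M * h x + t / 512 := by
        field_simp; ring
      linarith
    obtain ⟨_, ⟨i, rfl⟩, h1, h2⟩ := hh τ hτ
    refine ⟨f i, ⟨i, rfl⟩, ?_, ?_⟩
    · intro x hx hxτ
      have := h1 x hx hxτ
      simp only at this
      rw [div_le_iff₀ (by positivity)] at this
      simp only [auxTr] at this
      have h3 := (le_max_right (-M) (min M (f i x))).trans this
      have h4 := hi x hx
      rcases min_le_iff.mp h3 with h5 | h5 <;> linarith
    · intro x hx
      have := h2 x hx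
      simp only at this
      rw [le_div_iff₀ (by positivity)] at this
      have e : (h x + t / (4 * M) / 256) * (2 * M) = 2 * M * h x + t / 512 := by
        field_simp; ring
      rw [e] at this
      simp only [auxTr] at this
      have h4 := lo x (hτ hx)
      rcases le_max_iff.mp this with h5 | h5
      · linarith
      · exact h5.trans (min_le_right _ _)
  · rwa [one_div_div] at hlog

lemma aux_trunc {Ω : Type*} [Fintype Ω] (μ : Ω → ℝ) (hμ : ∀ x, 0 ≤ μ x) (p q M : ℝ) (hp : 1 ≤ p)
    (hpq : p < q) (hM : 0 < M) (f : Ω → ℝ) (hf : lpNormFin μ q f ≤ 1) (ε : ℝ) (hε : 0 ≤ ε)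
    (hMε : M ^ (p - q) ≤ ε ^ p) :
    lpNormFin μ p (f - auxTr M f) ≤ ε := by
  unfold lpNormFin at hf ⊢
  have hq0 : 0 < q := by linarith
  have hp0 : 0 < p := by linarith
  have hnn : 0 ≤ ∑ x, μ x * |f x| ^ q :=
    Finset.sum_nonneg fun x _ => mul_nonneg (hμ x) (by positivity)
  have h1 : ∑ x, μ x * |f x| ^ q ≤ 1 := by
    have h2 := Real.rpow_le_rpow (by positivity) hf hq0.le
    rwa [← Real.rpow_mul hnn, one_div_mul_cancel hq0.ne', Real.rpow_one, Real.one_rpow] at h2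
  have hpt : ∀ x, |(f - auxTr M f) x| ^ p ≤ |f x| ^ q * M ^ (p - q) := by
    intro x
    rw [Pi.sub_apply]
    by_cases hx : |f x| ≤ M
    · have h := abs_le.mp hx
      have : auxTr M f x = f x := by
        simp only [auxTr]; rw [min_eq_right h.2, max_eq_right h.1]
      rw [this, sub_self, abs_zero, Real.zero_rpow hp0.ne']
      positivity
    · push Not at hx
      have hfx : 0 < |f x| := by linarith
      have h2 : |f x - auxTr M f x| ≤ |f x| := by
        simp only [auxTr]
        rcases lt_abs.mp hx with h | h
        · rw [min_eq_left h.le, max_eq_right (by linarith), abs_of_pos (by linarith : 0 < f x), abs_of_pos (by linarith)]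
          linarith
        · rw [min_eq_right (by linarith), max_eq_left (by linarith), abs_of_neg (by linarith : f x < 0), abs_of_neg (by linarith)]
          linarith
      calc |f x - auxTr M f x| ^ p ≤ |f x| ^ p := Real.rpow_le_rpow (abs_nonneg _) h2 hp0.le
        _ = |f x| ^ q * |f x| ^ (p - q) := by rw [← Real.rpow_add hfx]; congr 1; ring
        _ ≤ _ := by
          refine mul_le_mul_of_nonneg_left ?_ (by positivity)
          exact Real.rpow_le_rpow_of_nonpos hM hx.le (sub_nonpos.mpr hpq.le)
  have h3 : ∑ x, μ x * |(f - auxTr M f) x| ^ p ≤ ε ^ p := by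
    calc _ ≤ ∑ x, μ x * (|f x| ^ q * M ^ (p - q)) :=
          Finset.sum_le_sum fun x _ => mul_le_mul_of_nonneg_left (hpt x) (hμ x)
      _ = (∑ x, μ x * |f x| ^ q) * M ^ (p - q) := by
          rw [Finset.sum_mul]; exact Finset.sum_congr rfl fun x _ => by ring
      _ ≤ 1 * M ^ (p - q) := by gcongr
      _ ≤ _ := by rw [one_mul]; exact hMε
  have h4 := Real.rpow_le_rpow (Finset.sum_nonneg fun x _ => mul_nonneg (hμ x) (by positivity)) h3
    (by positivity : 0 ≤ 1 / p)
  rwa [← Real.rpow_mul hε, mul_one_div_cancel hp0.ne', Real.rpow_one] at h4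

lemma aux_lp_symm {Ω : Type*} [Fintype Ω] (μ : Ω → ℝ) (p : ℝ) (f g : Ω → ℝ) :
    lpNormFin μ p (f - g) = lpNormFin μ p (g - f) := by
  unfold lpNormFin
  simp only [Pi.sub_apply, abs_sub_comm]

lemma aux_conclude {Ω : Type*} [Fintype Ω] (F : Set (Ω → ℝ)) (m : ℕ) (f : Fin m → Ω → ℝ)
    (hf : ∀ i, f i ∈ F) (p t M R c : ℝ) (hR : 0 ≤ R) (ht : 0 < t) (ht2 : t < 1 / 2)
    (hc : 0 < c) (hc1 : c ≤ 1 / 512)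
    (hlogM : Real.log (4 * M / t) ≤ R * (3 * Real.log (1 / t)))
    (h : ∃ σ : Finset Ω, Shatters (Set.range f) (t / 512) σ ∧
      Real.log m ≤ 36 * p ^ 2 * σ.card * Real.log (4 * M / t)) :
    Real.log m ≤ 108 * (p ^ 2 * R) * (combDim F (c * t)).toReal * Real.log (1 / (c * t)) := by
  obtain ⟨σ, ⟨h, hσ⟩, hlog⟩ := h
  have hsh : Shatters F (c * t) σ := by
    refine ⟨h, fun τ hτ => ?_⟩
    obtain ⟨_, ⟨i, rfl⟩, h1, h2⟩ := hσ τ hτ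
    refine ⟨f i, hf i, h1, fun x hx => ?_⟩
    have := h2 x hx
    nlinarith
  have hfin : combDim F (c * t) ≠ ∞ := by
    have : combDim F (c * t) ≤ (Fintype.card Ω : ℝ≥0∞) := by
      unfold combDim
      refine iSup₂_le fun σ _ => ?_
      exact_mod_cast Finset.card_le_univ σ
    exact ne_top_of_le_ne_top (ENNReal.natCast_ne_top _) this
  have hle : (σ.card : ℝ) ≤ (combDim F (c * t)).toReal := by
    have : (σ.card : ℝ≥0∞) ≤ combDim F (c * t) := by
      unfold combDim
      exact le_iSup₂_of_le σ hsh le_rfl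
    have := ENNReal.toReal_mono hfin this
    simpa using this
  have hl0 : 0 ≤ Real.log (1 / t) := Real.log_nonneg (by rw [le_div_iff₀ ht]; linarith)
  have hl1 : Real.log (1 / t) ≤ Real.log (1 / (c * t)) := by
    apply Real.log_le_log (by positivity)
    apply one_div_le_one_div_of_le (by positivity)
    nlinarith
  calc Real.log m ≤ _ := hlog
    _ ≤ 36 * p ^ 2 * σ.card * (R * (3 * Real.log (1 / t))) := by gcongr
    _ = 108 * (p ^ 2 * R) * σ.card * Real.log (1 / t) := by ring
    _ ≤ _ := by gcongr

open Classical in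
/-- Let `1 ≤ p < q ≤ ∞` and let `F` be `1`-bounded in `L_q(Ω,μ)` on a
finite probability space. Then for `0 < t < 1/2`,
`D(F, L_p, t) ≤ C_{p,q}·v(F, c_{p,q} t)·log(1/(c_{p,q} t))` where
`C_{p,q} = C·p²q/(q−p)` and `c_{p,q} = c·min(1, ((q−p)/p)^{1/p})` (interpreted as
`C_{p,q} = C·p²`, `c_{p,q} = c` for `q = ∞`). -/
theorem entropy_Lp_le_dimension :
    ∃ C > (0 : ℝ), ∃ c > (0 : ℝ),
      ∀ (Ω : Type) [Fintype Ω], ∀ (μ : Ω → ℝ) (p : ℝ) (q : ℝ≥0∞)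
        (F : Set (Ω → ℝ)) (t : ℝ),
      (∀ x, 0 ≤ μ x) → (∑ x, μ x = 1) →
      1 ≤ p → ENNReal.ofReal p < q →
      (∀ f ∈ F, (q = ∞ → ∀ x, 0 < μ x → |f x| ≤ 1) ∧
        (q ≠ ∞ → lpNormFin μ q.toReal f ≤ 1)) →
      0 < t → t < 1 / 2 →
      entropyWrt (lpNormFin μ p) F t ≤
        ENNReal.ofReal
          ((C * (if q = ∞ then p ^ 2 else p ^ 2 * q.toReal / (q.toReal - p))) *
            (combDim F
              ((if q = ∞ then c else c * min 1 (((q.toReal - p) / p) ^ (1 / p))) * t)).toReal *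
            Real.log (1 /
              ((if q = ∞ then c else c * min 1 (((q.toReal - p) / p) ^ (1 / p))) * t))) := by
  refine ⟨108, by norm_num, 1 / 512, by norm_num, ?_⟩
  intro Ω _ μ p q F t hμ hμ1 hp hpq hF ht ht2
  unfold entropyWrt
  refine iSup₂_le fun m hm => ?_
  obtain ⟨f, hf, hsep⟩ := hm
  rcases Nat.lt_or_ge m 2 with hm2 | hm2
  · have : Real.log m = 0 := by interval_cases m <;> simp
    rw [this]; simp
  apply ENNReal.ofReal_le_ofReal
  have hsep' : ∀ i j, i ≠ j → t ≤ lpNormFin μ p (f i - f j) := by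
    intro i j hij
    rcases lt_or_gt_of_ne hij with h | h
    · exact hsep i j h
    · rw [aux_lp_symm]; exact hsep j i h
  have hl4 : Real.log (4 / t) ≤ 3 * Real.log (1 / t) := by
    rw [show 3 * Real.log (1 / t) = ((3:ℕ):ℝ) * Real.log (1 / t) by norm_num, ← Real.log_pow]
    apply Real.log_le_log (by positivity)
    rw [div_pow, one_pow, div_le_div_iff₀ ht (by positivity)]
    have : t ^ 2 ≤ 1 / 4 := by nlinarith
    nlinarith
  by_cases hq : q = ∞
  · simp only [if_pos hq]
    have := aux_conclude F m f hf p t 1 1 (1 / 512) zero_le_one ht ht2 (by norm_num) le_rfl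
      (by simpa using hl4)
      (aux_reduce μ hμ hμ1 m hm2 f p t 1 hp ht ht2 le_rfl (fun i j hij => by
        have h1 := hsep' i j hij
        have h2 : lpNormFin μ p (auxTr 1 (f i) - auxTr 1 (f j)) = lpNormFin μ p (f i - f j) := by
          unfold lpNormFin
          congr 1
          refine Finset.sum_congr rfl fun x _ => ?_
          rcases (hμ x).eq_or_lt with h0 | h0
          · rw [← h0]; simp
          · have e : ∀ i, auxTr 1 (f i) x = f i x := by
              intro i
              have h := abs_le.mp ((hF (f i) (hf i)).1 hq x h0)
              simp only [auxTr]; rw [min_eq_right h.2, max_eq_right h.1]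
            simp only [Pi.sub_apply, e]
        rw [h2]; linarith))
    simpa using this
  · simp only [if_neg hq]
    set r := q.toReal with hr
    have hpr : p < r := (ENNReal.ofReal_lt_iff_lt_toReal (by linarith) hq).mp hpq
    have hrp : 0 < r - p := by linarith
    have hp0 : 0 < p := by linarith
    have h4t : 1 ≤ 4 / t := by rw [le_div_iff₀ ht]; linarith
    set M := (4 / t) ^ (p / (r - p)) with hM
    have hM1 : 1 ≤ M := Real.one_le_rpow h4t (by positivity)
    have hMp : M ^ (p - r) ≤ (t / 4) ^ p := by
      rw [hM, ← Real.rpow_mul (by positivity), show p / (r - p) * (p - r) = -p by field_simp; ring,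
        Real.rpow_neg (by positivity), ← Real.inv_rpow (by positivity), inv_div]
    have hlogM : Real.log (4 * M / t) ≤ r / (r - p) * (3 * Real.log (1 / t)) := by
      rw [show 4 * M / t = (4 / t) * M by ring, Real.log_mul (by positivity) (by positivity), hM,
        Real.log_rpow (by positivity)]
      calc _ = r / (r - p) * Real.log (4 / t) := by field_simp; ring
        _ ≤ _ := by gcongr
    have hmin : 0 < min 1 (((r - p) / p) ^ (1 / p)) := by positivity
    have := aux_conclude F m f hf p t M (r / (r - p)) (1 / 512 * min 1 (((r - p) / p) ^ (1 / p)))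
      (by apply div_nonneg <;> linarith) ht ht2 (by positivity)
      (by have := min_le_left 1 (((r - p) / p) ^ (1 / p)); linarith) hlogM
      (aux_reduce μ hμ hμ1 m hm2 f p t M hp ht ht2 hM1 (fun i j hij => by
        have h1 := hsep' i j hij
        have hb : ∀ i, lpNormFin μ p (f i - auxTr M (f i)) ≤ t / 4 := fun i =>
          aux_trunc μ hμ p r M hp hpr (by linarith) (f i) ((hF (f i) (hf i)).2 hq) (t / 4)
            (by positivity) hMp
        have e : f i - f j = (f i - auxTr M (f i)) +
            ((auxTr M (f i) - auxTr M (f j)) + (auxTr M (f j) - f j)) := by abel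
        have h2 := aux_lp_add μ hμ p hp (f i - auxTr M (f i))
          ((auxTr M (f i) - auxTr M (f j)) + (auxTr M (f j) - f j))
        have h3 := aux_lp_add μ hμ p hp (auxTr M (f i) - auxTr M (f j)) (auxTr M (f j) - f j)
        rw [← e] at h2
        rw [aux_lp_symm μ p (auxTr M (f j)) (f j)] at h3
        linarith [hb i, hb j]))
    rw [mul_div_assoc]
    exact this
end
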